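/- arXiv:2210.09344 — 4 statements merged into one kernel-verified Lean document; each statement's English description precedes it below -/
import Mathlib

section
/- Let R be a commutative Noetherian ring, A a projective Noetherian R-algebra, Q a finitely generated A-module projective over R with DQ ⊗_A Q projective over R, and B = End_A(Q)^op. For a finitely generated A-module M projective over R, the counit χ_M : Q ⊗_B Hom_A(Q, M) → M is an isomorphism if and only if DQ-domdim_{(A,R)} DM ≥ 2. -/
universe u
open Function TensorProduct

namespace RelDom

section


variable (R : Type u) [CommRing R] (A : Type u) [Ring A] [Algebra R A]

/-- `M` is a direct summand of a finite direct sum of copies of `T`, i.e. `M ∈ add T`. -/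
def InAdd (T : Type u) [AddCommGroup T] [Module A T]
    (M : Type u) [AddCommGroup M] [Module A M] : Prop :=
  ∃ (n : ℕ) (i : M →ₗ[A] (Fin n → T)) (p : (Fin n → T) →ₗ[A] M), ∀ m, p (i m) = m

/-- `f` is an `(A,R)`-monomorphism : an injective `A`-linear map admitting an
`R`-linear retraction (the `R`-action being the one through `algebraMap R A`). -/
def RSplitMono {M N : Type u} [AddCommGroup M] [Module A M]
    [AddCommGroup N] [Module A N] (f : M →ₗ[A] N) : Prop :=
  Injective f ∧ ∃ r : N →+ M,
    (∀ (s : R) (x : N), r (algebraMap R A s • x) = algebraMap R A s • r x) ∧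
    ∀ m, r (f m) = m

/-- `f` is an `(A,R)`-epimorphism : a surjective `A`-linear map admitting an
`R`-linear section. -/
def RSplitEpi {M N : Type u} [AddCommGroup M] [Module A M]
    [AddCommGroup N] [Module A N] (f : M →ₗ[A] N) : Prop :=
  Surjective f ∧ ∃ s : N →+ M,
    (∀ (c : R) (x : N), s (algebraMap R A c • x) = algebraMap R A c • s x) ∧
    ∀ x, f (s x) = x

/-- A submodule `p ≤ N` is an `R`-direct summand of `N`. -/
def RSummand {N : Type u} [AddCommGroup N] [Module A N] (p : Submodule A N) : Prop :=
  ∃ r : N →+ p, (∀ (c : R) (x : N), r (algebraMap R A c • x) = algebraMap R A c • r x) ∧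
    ∀ x : p, r x = x

/-- `Q`-relative dominant dimension of `M` is at least `n`:
there is an `(A,R)`-exact sequence `0 → M → T₁ → ⋯ → Tₙ` with all `Tᵢ ∈ add Q`
which stays exact under `Hom_A(-, Q)`. -/
def DomdimGE (Q : Type u) [AddCommGroup Q] [Module A Q] :
    ℕ → ModuleCat.{u} A → Prop
  | 0, _ => True
  | n + 1, M =>
      ∃ (T : ModuleCat.{u} A) (_ : InAdd A Q T) (f : M →ₗ[A] T),
        RSplitMono R A f ∧
        (∀ g : (M : Type u) →ₗ[A] Q, ∃ h : (T : Type u) →ₗ[A] Q, ∀ m, h (f m) = g m) ∧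
        DomdimGE Q n (ModuleCat.of A ((T : Type u) ⧸ LinearMap.range f))

/-- `Q`-relative codominant dimension of `M` is at least `n`. -/
def CodomdimGE (Q : Type u) [AddCommGroup Q] [Module A Q] :
    ℕ → ModuleCat.{u} A → Prop
  | 0, _ => True
  | n + 1, M =>
      ∃ (T : ModuleCat.{u} A) (_ : InAdd A Q T) (f : T →ₗ[A] M),
        RSplitEpi R A f ∧
        (∀ g : Q →ₗ[A] (M : Type u), ∃ h : Q →ₗ[A] (T : Type u), ∀ q, f (h q) = g q) ∧
        CodomdimGE Q n (ModuleCat.of A (LinearMap.ker f))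

/-- The relative dominant dimension of `M` with respect to `Q`, as a value in `ℕ∞`. -/
noncomputable def Domdim (Q : Type u) [AddCommGroup Q] [Module A Q]
    (M : ModuleCat.{u} A) : ℕ∞ :=
  ⨆ (n : ℕ) (_ : DomdimGE R A Q n M), (n : ℕ∞)

/-- The relative codominant dimension of `M` with respect to `Q`, as a value in `ℕ∞`. -/
noncomputable def Codomdim (Q : Type u) [AddCommGroup Q] [Module A Q]
    (M : ModuleCat.{u} A) : ℕ∞ :=
  ⨆ (n : ℕ) (_ : CodomdimGE R A Q n M), (n : ℕ∞)


end

section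


variable (R : Type u) [CommRing R] (A : Type u) [Ring A] [Algebra R A]

section Dual

variable (S : Type u) [Ring S]
variable (M : Type u) [AddCommGroup M] [Module R M] [Module S M] [SMulCommClass S R M]

/-- scalar action of `a : S` as an `R`-linear endomorphism. -/
def smulEnd (a : S) : M →ₗ[R] M where
  toFun m := a • m
  map_add' := smul_add a
  map_smul' r m := smul_comm a r m

/-- The standard duality `D = Hom_R(-, R)` turns a left `S`-module into a right
`S`-module, i.e. a module over `Sᵐᵒᵖ`. -/
instance dualModule : Module Sᵐᵒᵖ (M →ₗ[R] R) where
  smul a f := f ∘ₗ smulEnd R S M a.unop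
  one_smul f := LinearMap.ext fun m => by
    show f ((1 : Sᵐᵒᵖ).unop • m) = f m
    simp
  mul_smul a b f := LinearMap.ext fun m => by
    show f ((a * b).unop • m) = f (b.unop • a.unop • m)
    rw [MulOpposite.unop_mul, mul_smul]
  smul_zero a := LinearMap.ext fun m => rfl
  smul_add a f g := LinearMap.ext fun m => rfl
  add_smul a b f := LinearMap.ext fun m => by
    show f ((a + b).unop • m) = f (a.unop • m) + f (b.unop • m)
    rw [MulOpposite.unop_add, add_smul, map_add]
  zero_smul f := LinearMap.ext fun m => by
    show f ((0 : Sᵐᵒᵖ).unop • m) = 0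
    rw [MulOpposite.unop_zero, zero_smul, map_zero]

lemma dual_smul_apply (a : Sᵐᵒᵖ) (f : M →ₗ[R] R) (m : M) :
    (a • f) m = f (a.unop • m) := rfl

end Dual

section Coind

/-- The left `A`-module structure on `Hom_R(A, R)`, the dual of the *right*
regular module: `(a • f) x = f (x * a)`. -/
instance coindModule : Module A (A →ₗ[R] R) where
  smul a f := f ∘ₗ
    { toFun := fun x => x * a
      map_add' := fun x y => add_mul x y a
      map_smul' := fun r x => smul_mul_assoc r x a }
  one_smul f := LinearMap.ext fun x => by
    show f (x * 1) = f x
    rw [mul_one]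
  mul_smul a b f := LinearMap.ext fun x => by
    show f (x * (a * b)) = f ((x * a) * b)
    rw [mul_assoc]
  smul_zero a := LinearMap.ext fun x => rfl
  smul_add a f g := LinearMap.ext fun x => rfl
  add_smul a b f := LinearMap.ext fun x => by
    show f (x * (a + b)) = f (x * a) + f (x * b)
    rw [mul_add, map_add]
  zero_smul f := LinearMap.ext fun x => by
    show f (x * 0) = 0
    rw [mul_zero, map_zero]

lemma coind_smul_apply (a : A) (f : A →ₗ[R] R) (x : A) :
    (a • f) x = f (x * a) := rfl

end Coind

section TensorOver

variable (X : Type u) [AddCommGroup X] [Module R X] [Module Aᵐᵒᵖ X]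
variable (Y : Type u) [AddCommGroup Y] [Module R Y] [Module A Y]

/-- The balancing relations for the tensor product over the (possibly
noncommutative) `R`-algebra `A`. -/
def balanceRel : Set (X ⊗[R] Y) :=
  {z | ∃ (x : X) (a : A) (y : Y),
    z = (MulOpposite.op a • x) ⊗ₜ[R] y - x ⊗ₜ[R] (a • y)}

/-- The tensor product `X ⊗_A Y` of a right `A`-module `X` and a left `A`-module `Y`
over the `R`-algebra `A`, realized as a quotient of `X ⊗[R] Y`. -/
abbrev TensorOver : Type u :=
  (X ⊗[R] Y) ⧸ Submodule.span R (balanceRel R A X Y)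

end TensorOver


end

section


variable (R : Type u) [CommRing R] (A : Type u) [Ring A] [Algebra R A]

section Counit

variable (Q : Type u) [AddCommGroup Q] [Module R Q] [Module A Q]
variable (M : Type u) [AddCommGroup M] [Module R M] [Module A M]
variable [SMulCommClass A R M] [SMulCommClass R A Q] [IsScalarTower R A Q] [IsScalarTower R A M]
variable [SMulCommClass R A M]

/-- `Hom_A(Q, M)` is a right module over `E := End_A(Q)`, i.e. a left module over
`Eᵐᵒᵖ = End_A(Q)ᵐᵒᵖ`, by precomposition.  Note that `End_A(Q)ᵐᵒᵖ` is exactly the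
algebra `B = End_A(Q)ᵒᵖ` and `Hom_A(Q,M)` is the usual left `B`-module `F_Q M`. -/
instance homEndModule : Module (Module.End A Q)ᵐᵒᵖ (Q →ₗ[A] M) where
  smul b g := g ∘ₗ b.unop
  one_smul g := LinearMap.ext fun q => rfl
  mul_smul a b g := LinearMap.ext fun q => rfl
  smul_zero b := LinearMap.ext fun q => rfl
  smul_add b f g := LinearMap.ext fun q => rfl
  add_smul a b g := LinearMap.ext fun q => by
    show g ((a + b).unop q) = g (a.unop q) + g (b.unop q)
    rw [MulOpposite.unop_add, LinearMap.add_apply, map_add]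
  zero_smul g := LinearMap.ext fun q => by
    show g ((0 : (Module.End A Q)ᵐᵒᵖ).unop q) = 0
    rw [MulOpposite.unop_zero, LinearMap.zero_apply, map_zero]

lemma homEnd_smul_apply (b : (Module.End A Q)ᵐᵒᵖ) (g : Q →ₗ[A] M) (q : Q) :
    (b • g) q = g (b.unop q) := rfl

/-- The balancing relations for `Q ⊗_B Hom_A(Q, M)`, where `B = End_A(Q)ᵒᵖ`. -/
def counitRel : Set (Q ⊗[R] (Q →ₗ[A] M)) :=
  {z | ∃ (q : Q) (b : Module.End A Q) (g : Q →ₗ[A] M),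
    z = (b q) ⊗ₜ[R] g - q ⊗ₜ[R] (g ∘ₗ b)}

/-- `Q ⊗_B Hom_A(Q, M)`, where `B = End_A(Q)ᵒᵖ`, as a left `A`-module. -/
abbrev CounitDom : Type u :=
  (Q ⊗[R] (Q →ₗ[A] M)) ⧸ Submodule.span A (counitRel R A Q M)

/-- evaluation, `A`-linearly in the first variable -/
noncomputable def evalHom : Q →ₗ[A] ((Q →ₗ[A] M) →ₗ[R] M) where
  toFun q :=
    { toFun := fun g => g q
      map_add' := fun g h => rfl
      map_smul' := fun r g => rfl }
  map_add' q q' := LinearMap.ext fun g => g.map_add q q'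
  map_smul' a q := LinearMap.ext fun g => g.map_smul a q

noncomputable def counitAux : (Q ⊗[R] (Q →ₗ[A] M)) →ₗ[A] M :=
  TensorProduct.AlgebraTensorModule.lift (evalHom R A Q M)

/-- The counit `χ_M : Q ⊗_B Hom_A(Q, M) → M`, `q ⊗ g ↦ g q`. -/
noncomputable def counit : CounitDom R A Q M →ₗ[A] M :=
  Submodule.liftQ _ (counitAux R A Q M) (by
    rw [Submodule.span_le]
    rintro z ⟨q, b, g, rfl⟩
    simp [counitAux, evalHom, SetLike.mem_coe, LinearMap.mem_ker])

end Counit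

section Tor

variable (S : Type u) [Ring S]
variable (X : Type u) [AddCommGroup X] [Module Sᵐᵒᵖ X]

/-- The map obtained from an `S`-linear map between finite free left `S`-modules
by tensoring with the right `S`-module `X` (under `X ⊗_S S^m ≅ X^m`). -/
noncomputable def piMap {m n : ℕ} (d : (Fin m → S) →ₗ[S] (Fin n → S)) (v : Fin m → X) :
    Fin n → X :=
  fun i => ∑ j, MulOpposite.op (d (Pi.single j 1) i) • v j

variable (Y : Type u) [AddCommGroup Y] [Module S Y]

/-- `Tor_i^S(X, Y) = 0` for all `1 ≤ i ≤ q`, expressed via a resolution of `Y` by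
finite free left `S`-modules, tensored over `S` with the right `S`-module `X`. -/
noncomputable def TorVanishUpTo (q : ℕ) : Prop :=
  ∃ (k : ℕ → ℕ) (d : ∀ n, (Fin (k (n+1)) → S) →ₗ[S] (Fin (k n) → S))
    (ε : (Fin (k 0) → S) →ₗ[S] Y),
    Surjective ε ∧ LinearMap.ker ε = LinearMap.range (d 0) ∧
    (∀ n, LinearMap.ker (d n) = LinearMap.range (d (n+1))) ∧
    ∀ i, i + 1 ≤ q → ∀ v : Fin (k (i+1)) → X, piMap S X (d i) v = 0 →
      ∃ w : Fin (k (i+2)) → X, piMap S X (d (i+1)) w = v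

end Tor

section Ext

open CategoryTheory

/-- Vanishing of `Ext_A^i(X, Y)`. -/
def ExtVanish (X Y : ModuleCat.{u} A) (i : ℕ) : Prop :=
  Subsingleton ((((_root_.Ext ℤ (ModuleCat.{u} A) i).obj (Opposite.op X)).obj Y : Type u))

end Ext

section InjDim

/-- `M` admits a finite injective coresolution of length `≤ d`, i.e. the injective
dimension of `M` is at most `d`. -/
def InjCoresLE : ℕ → ModuleCat.{u} A → Prop
  | 0, M => Module.Injective A M
  | d + 1, M => ∃ (I : ModuleCat.{u} A) (f : M →ₗ[A] I),
      Module.Injective A I ∧ Injective f ∧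
      InjCoresLE d (ModuleCat.of A ((I : Type u) ⧸ LinearMap.range f))

end InjDim


end

end RelDom

open RelDom Function TensorProduct

namespace RelDom4

section Alg
variable {R : Type u} [CommRing R]
variable {A : Type u} [Ring A] [Algebra R A]
variable {Q : Type u} [AddCommGroup Q] [Module R Q] [Module A Q]
  [IsScalarTower R A Q] [SMulCommClass A R Q] [SMulCommClass R A Q]
variable {M : Type u} [AddCommGroup M] [Module R M] [Module A M]
  [IsScalarTower R A M] [SMulCommClass A R M] [SMulCommClass R A M]

/-- The class of `q ⊗ g`. -/
def mkT (q : Q) (g : Q →ₗ[A] M) : CounitDom R A Q M := Submodule.Quotient.mk (q ⊗ₜ[R] g)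

lemma counit_mkT (q : Q) (g : Q →ₗ[A] M) : counit R A Q M (mkT q g) = g q := by
  simp [mkT, counit, counitAux, evalHom]

lemma mkT_add_left (q q' : Q) (g : Q →ₗ[A] M) :
    (mkT (q + q') g : CounitDom R A Q M) = mkT q g + mkT q' g := by
  simp [mkT, TensorProduct.add_tmul]

lemma mkT_zero_left (g : Q →ₗ[A] M) :
    (mkT 0 g : CounitDom R A Q M) = 0 := by
  simp [mkT]

lemma mkT_zero_right (q : Q) : (mkT q (0 : Q →ₗ[A] M) : CounitDom R A Q M) = 0 := by
  simp [mkT]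

lemma mkT_add_right (q : Q) (g g' : Q →ₗ[A] M) :
    (mkT q (g + g') : CounitDom R A Q M) = mkT q g + mkT q g' := by
  simp [mkT, TensorProduct.tmul_add]

lemma mkT_sum_right {ι : Type} (s : Finset ι) (q : Q) (g : ι → Q →ₗ[A] M) :
    (mkT q (∑ k ∈ s, g k) : CounitDom R A Q M) = ∑ k ∈ s, mkT q (g k) :=
  map_sum (AddMonoidHom.mk' (fun g => (mkT q g : CounitDom R A Q M)) (mkT_add_right q)) g s

lemma mkT_balance (q : Q) (b : Q →ₗ[A] Q) (g : Q →ₗ[A] M) :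
    (mkT (b q) g : CounitDom R A Q M) = mkT q (g ∘ₗ b) := by
  rw [mkT, mkT, Submodule.Quotient.eq]
  exact Submodule.subset_span ⟨q, b, g, rfl⟩

/-- `x ↦ ∑ x_k ⊗ φ_k`. -/
def Phi {n : ℕ} (φ : (Fin n → Q) →ₗ[A] M) : (Fin n → Q) →+ CounitDom R A Q M :=
  AddMonoidHom.mk' (fun x => ∑ k, mkT (x k) (φ ∘ₗ LinearMap.single A (fun _ => Q) k))
    (fun x y => by simp [mkT_add_left, Finset.sum_add_distrib])

lemma Phi_apply {n : ℕ} (φ : (Fin n → Q) →ₗ[A] M) (x : Fin n → Q) :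
    (Phi φ x : CounitDom R A Q M) =
      ∑ k, mkT (x k) (φ ∘ₗ LinearMap.single A (fun _ => Q) k) := rfl

lemma sum_single_apply {n : ℕ} (x : Fin n → Q) :
    ∑ k, LinearMap.single A (fun _ => Q) k (x k) = x := by
  simpa using Finset.univ_sum_single x

lemma counit_Phi {n : ℕ} (φ : (Fin n → Q) →ₗ[A] M) (x : Fin n → Q) :
    counit R A Q M (Phi φ x) = φ x := by
  rw [Phi_apply, map_sum]
  simp only [counit_mkT, LinearMap.comp_apply]
  rw [← map_sum, sum_single_apply]

lemma Phi_one {n : ℕ} (φ : (Fin n → Q) →ₗ[A] M) (h : Q →ₗ[A] (Fin n → Q)) (q : Q) :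
    (Phi φ (h q) : CounitDom R A Q M) = mkT q (φ ∘ₗ h) := by
  have : φ ∘ₗ h = ∑ k, (φ ∘ₗ LinearMap.single A (fun _ => Q) k) ∘ₗ (LinearMap.proj k ∘ₗ h) := by
    ext x
    simp only [LinearMap.comp_apply, LinearMap.sum_apply, LinearMap.proj_apply]
    rw [← map_sum, sum_single_apply]
  rw [this, mkT_sum_right, Phi_apply]
  refine Finset.sum_congr rfl fun k _ => ?_
  rw [← mkT_balance]
  rfl

lemma Phi_zero_of_comp {n m : ℕ} (φ : (Fin n → Q) →ₗ[A] M)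
    (σ : (Fin m → Q) →ₗ[A] (Fin n → Q)) (h0 : ∀ z, φ (σ z) = 0) (z : Fin m → Q) :
    (Phi φ (σ z) : CounitDom R A Q M) = 0 := by
  conv_lhs => rw [← sum_single_apply (A := A) z]
  rw [map_sum, map_sum]
  refine Finset.sum_eq_zero fun l _ => ?_
  have := Phi_one (R := R) φ (σ ∘ₗ LinearMap.single A (fun _ => Q) l) (z l)
  rw [LinearMap.comp_apply] at this
  rw [this]
  have h1 : φ ∘ₗ σ ∘ₗ LinearMap.single A (fun _ => Q) l = 0 := LinearMap.ext fun x => h0 _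
  rw [h1, mkT_zero_right]

lemma exists_Phi {n : ℕ} (π : (Fin n → Q) →ₗ[A] M)
    (lift : ∀ g : Q →ₗ[A] M, ∃ h : Q →ₗ[A] (Fin n → Q), π ∘ₗ h = g)
    (z : CounitDom R A Q M) : ∃ x, Phi π x = z := by
  obtain ⟨t, rfl⟩ := Submodule.Quotient.mk_surjective _ z
  induction t with
  | zero => exact ⟨0, by simp⟩
  | tmul q g =>
    obtain ⟨h, rfl⟩ := lift g
    exact ⟨h q, Phi_one _ _ _⟩
  | add a b ha hb =>
    obtain ⟨x, hx⟩ := ha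
    obtain ⟨y, hy⟩ := hb
    exact ⟨x + y, by rw [map_add, hx, hy, Submodule.Quotient.mk_add]⟩

lemma alg_bij {n m : ℕ} (π : (Fin n → Q) →ₗ[A] M) (hπ : Surjective π)
    (lift : ∀ g : Q →ₗ[A] M, ∃ h : Q →ₗ[A] (Fin n → Q), π ∘ₗ h = g)
    (e : (Fin n → Q) →ₗ[A] (Fin n → Q)) (he : ∀ x, π (e x) = 0)
    (σ : (Fin m → Q) →ₗ[A] (Fin n → Q)) (hσ : ∀ x, π (σ x) = 0)
    (hk : ∀ x, π x = 0 → ∃ y z, x = e y + σ z) :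
    Bijective (counit R A Q M) := by
  constructor
  · rw [injective_iff_map_eq_zero]
    intro t ht
    obtain ⟨x, rfl⟩ := exists_Phi π lift t
    rw [counit_Phi] at ht
    obtain ⟨y, z, rfl⟩ := hk x ht
    rw [map_add, Phi_zero_of_comp π e he, Phi_zero_of_comp π σ hσ, add_zero]
  · intro x
    obtain ⟨y, rfl⟩ := hπ x
    exact ⟨_, counit_Phi π y⟩

/-- Right exactness of the tensor product, in the form needed. -/
lemma ker_gen {n : ℕ} (π : (Fin n → Q) →ₗ[A] M)
    (lift : ∀ g : Q →ₗ[A] M, ∃ h : Q →ₗ[A] (Fin n → Q), π ∘ₗ h = g)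
    (hinj : Injective (counit R A Q M)) (I : Submodule A (Fin n → Q))
    (hI : ∀ h : Q →ₗ[A] (Fin n → Q), π ∘ₗ h = 0 → ∀ q, h q ∈ I)
    (x : Fin n → Q) (hx : π x = 0) : x ∈ I := by
  choose L hL using lift
  have key : ∀ (g : Q →ₗ[A] M) (h : Q →ₗ[A] (Fin n → Q)), π ∘ₗ h = g →
      ∀ q, I.mkQ (L g q) = I.mkQ (h q) := by
    intro g h hg q
    rw [← sub_eq_zero, ← map_sub, Submodule.mkQ_apply, Submodule.Quotient.mk_eq_zero]
    refine hI (L g - h) ?_ q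
    rw [LinearMap.comp_sub, hL, hg, sub_self]
  let F : Q →ₗ[A] ((Q →ₗ[A] M) →ₗ[R] ((Fin n → Q) ⧸ I)) :=
    { toFun := fun q =>
        { toFun := fun g => I.mkQ (L g q)
          map_add' := fun g g' => by
            rw [key (g + g') (L g + L g') (by rw [LinearMap.comp_add, hL, hL])]
            rw [LinearMap.add_apply, map_add]
          map_smul' := fun r g => by
            rw [key (r • g) (r • L g) (by
              ext y
              have h1 : π (L g y) = g y := LinearMap.congr_fun (hL g) y
              have h2 : π (r • L g y) = r • g y := by
                rw [← algebraMap_smul A r (L g y), map_smul, h1, algebraMap_smul]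
              exact h2)]
            rfl }
      map_add' := fun q q' => LinearMap.ext fun g => by simp
      map_smul' := fun a q => LinearMap.ext fun g => by simp }
  let G : CounitDom R A Q M →ₗ[A] ((Fin n → Q) ⧸ I) :=
    Submodule.liftQ _ (TensorProduct.AlgebraTensorModule.lift F) (by
      rw [Submodule.span_le]
      rintro z ⟨q, b, g, rfl⟩
      rw [SetLike.mem_coe, LinearMap.mem_ker, map_sub, sub_eq_zero]
      have := key (g ∘ₗ b) (L g ∘ₗ b) (by rw [← LinearMap.comp_assoc, hL]) q
      exact this.symm)
  have hG : ∀ q g, G (mkT q g) = I.mkQ (L g q) := fun q g => rfl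
  have h0 : (Phi π x : CounitDom R A Q M) = 0 := by
    apply hinj
    rw [counit_Phi, hx, map_zero]
  have h1 := congrArg G h0
  rw [Phi_apply, map_sum, map_zero] at h1
  simp only [hG] at h1
  rw [Finset.sum_congr rfl (fun k _ => key _ (LinearMap.single A (fun _ => Q) k) rfl (x k)),
    ← map_sum, sum_single_apply, Submodule.mkQ_apply, Submodule.Quotient.mk_eq_zero] at h1
  exact h1

end Alg

section Dual
variable {R : Type u} [CommRing R]
variable {A : Type u} [Ring A] [Algebra R A]
variable {X : Type u} [AddCommGroup X] [Module R X] [Module A X]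
  [IsScalarTower R A X] [SMulCommClass A R X] 
variable {Y : Type u} [AddCommGroup Y] [Module R Y] [Module A Y]
  [IsScalarTower R A Y] [SMulCommClass A R Y]

lemma algMap_smul_dual (c : R) (φ : X →ₗ[R] R) :
    (algebraMap R Aᵐᵒᵖ c) • φ = c • φ := by
  ext x
  rw [dual_smul_apply]
  simp

lemma sep [Module.Projective R Y] {y y' : Y} (h : ∀ φ : Y →ₗ[R] R, φ y = φ y') : y = y' := by
  rw [← sub_eq_zero, ← Module.forall_dual_apply_eq_zero_iff R]
  intro φ
  rw [map_sub, h, sub_self]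

lemma dualizeR [Module.Projective R Y] [Module.Finite R Y]
    (L : (Y →ₗ[R] R) →+ (X →ₗ[R] R))
    (hL : ∀ (c : R) φ, L (algebraMap R Aᵐᵒᵖ c • φ) = algebraMap R Aᵐᵒᵖ c • L φ) :
    ∃ h : X →ₗ[R] Y, ∀ φ x, L φ x = φ (h x) := by
  let L' : Module.Dual R Y →ₗ[R] Module.Dual R X :=
    { toFun := L
      map_add' := L.map_add
      map_smul' := fun c φ => by
        have := hL c φ
        rwa [algMap_smul_dual, algMap_smul_dual] at this }
  refine ⟨(Module.evalEquiv R Y).symm.toLinearMap ∘ₗ L'.dualMap ∘ₗ Module.Dual.eval R X, ?_⟩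
  intro φ x
  simp only [LinearMap.comp_apply, LinearEquiv.coe_coe]
  rw [Module.apply_evalEquiv_symm_apply]
  rfl

lemma dualizeA [Module.Projective R Y] [Module.Finite R Y]
    (L : (Y →ₗ[R] R) →ₗ[Aᵐᵒᵖ] (X →ₗ[R] R)) :
    ∃ h : X →ₗ[A] Y, ∀ φ x, L φ x = φ (h x) := by
  obtain ⟨h, hh⟩ := dualizeR (A := A) L.toAddMonoidHom (fun c φ => map_smul L _ φ)
  refine ⟨{ toFun := h, map_add' := h.map_add, map_smul' := fun a x => ?_ }, hh⟩
  refine sep (R := R) fun φ => ?_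
  rw [← hh]
  have h1 := hh (MulOpposite.op a • φ) x
  have h2 : L (MulOpposite.op a • φ) = MulOpposite.op a • L φ := map_smul L _ φ
  exact (LinearMap.congr_fun h2 x).symm.trans h1

/-- The dual of an `A`-linear map. -/
def dmap (h : X →ₗ[A] Y) : (Y →ₗ[R] R) →ₗ[Aᵐᵒᵖ] (X →ₗ[R] R) where
  toFun φ := φ ∘ₗ (h.restrictScalars R)
  map_add' _ _ := rfl
  map_smul' a φ := LinearMap.ext fun x => by
    show φ (a.unop • h x) = φ (h (a.unop • x))
    rw [h.map_smul]

lemma dmap_apply (h : X →ₗ[A] Y) (φ : Y →ₗ[R] R) (x : X) : dmap h φ x = φ (h x) := rfl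

/-- `D(Xⁿ) ≅ (DX)ⁿ`. -/
def dpi (n : ℕ) : ((Fin n → X) →ₗ[R] R) ≃ₗ[Aᵐᵒᵖ] (Fin n → (X →ₗ[R] R)) where
  toFun φ k := φ ∘ₗ LinearMap.single R (fun _ => X) k
  invFun ψ := ∑ k, ψ k ∘ₗ LinearMap.proj k
  map_add' _ _ := rfl
  map_smul' a φ := by
    funext k
    ext x
    show φ (a.unop • Pi.single k x) = φ (Pi.single k (a.unop • x))
    rw [Pi.single_smul]
  left_inv φ := by
    ext k x
    simp [LinearMap.sum_apply, ← map_sum]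
    rw [Finset.sum_eq_single k] <;> simp +contextual [Pi.single_apply]
  right_inv ψ := by
    funext k
    ext x
    simp [LinearMap.sum_apply]
    rw [Finset.sum_eq_single k] <;> simp +contextual [Pi.single_apply]

lemma inAdd_iff {T : Type u} [AddCommGroup T] [Module Aᵐᵒᵖ T]
    (h : InAdd Aᵐᵒᵖ (X →ₗ[R] R) T) : ∃ (n : ℕ) (i : T →ₗ[Aᵐᵒᵖ] ((Fin n → X) →ₗ[R] R))
      (p : ((Fin n → X) →ₗ[R] R) →ₗ[Aᵐᵒᵖ] T), ∀ t, p (i t) = t := by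
  obtain ⟨n, i, p, h⟩ := h
  exact ⟨n, (dpi n).symm.toLinearMap ∘ₗ i, p ∘ₗ (dpi n).toLinearMap, fun t => by simp [h]⟩

lemma inAdd_dual (n : ℕ) : InAdd Aᵐᵒᵖ (X →ₗ[R] R) ((Fin n → X) →ₗ[R] R) :=
  ⟨n, (dpi n).toLinearMap, (dpi n).symm.toLinearMap, fun t => by simp⟩

end Dual

end RelDom4
namespace RelDom4

instance projPi {R : Type u} [CommRing R] {Q : Type u} [AddCommGroup Q] [Module R Q]
    [Module.Projective R Q] (n : ℕ) : Module.Projective R (Fin n → Q) :=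
  Module.Projective.of_equiv (DFinsupp.linearEquivFunOnFintype (R := R) (M := fun _ : Fin n => Q))

section Main
variable {R : Type u} [CommRing R] [IsNoetherianRing R]
variable {A : Type u} [Ring A] [Algebra R A] [Module.Finite R A]
variable {Q : Type u} [AddCommGroup Q] [Module R Q] [Module A Q]
  [IsScalarTower R A Q] [SMulCommClass A R Q] [SMulCommClass R A Q]
  [Module.Finite R Q] [Module.Projective R Q]
variable {M : Type u} [AddCommGroup M] [Module R M] [Module A M]
  [IsScalarTower R A M] [SMulCommClass A R M] [SMulCommClass R A M]
  [Module.Finite R M]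

/-- Approximation of a finitely generated module by `Qⁿ`. -/
lemma exists_approx (N : Type u) [AddCommGroup N] [Module R N] [Module A N]
    [IsScalarTower R A N] [SMulCommClass A R N] [Module.Finite R N] :
    ∃ (n : ℕ) (π : (Fin n → Q) →ₗ[A] N),
      ∀ g : Q →ₗ[A] N, ∃ h : Q →ₗ[A] (Fin n → Q), π ∘ₗ h = g := by
  have : IsNoetherian R (Q →ₗ[R] N) := inferInstance
  let ρ : (Q →ₗ[A] N) →ₗ[R] (Q →ₗ[R] N) :=
    { toFun := fun g => g.restrictScalars R
      map_add' := fun _ _ => rfl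
      map_smul' := fun _ _ => rfl }
  have hfin : Module.Finite R (Q →ₗ[A] N) := Module.Finite.of_injective ρ (by
    intro g g' h
    ext x
    exact LinearMap.congr_fun h x)
  obtain ⟨n, g, hg⟩ := Module.Finite.exists_fin (R := R) (M := Q →ₗ[A] N)
  refine ⟨n, ∑ k, g k ∘ₗ LinearMap.proj k, fun f => ?_⟩
  have hf : f ∈ Submodule.span R (Set.range g) := by rw [hg]; trivial
  obtain ⟨c, rfl⟩ := (Submodule.mem_span_range_iff_exists_fun R).1 hf
  refine ⟨LinearMap.pi fun k => c k • LinearMap.id, ?_⟩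
  ext x
  simp only [LinearMap.comp_apply, LinearMap.sum_apply, LinearMap.proj_apply, LinearMap.pi_apply,
    LinearMap.smul_apply, LinearMap.id_apply]
  refine Finset.sum_congr rfl fun k _ => ?_
  rw [← algebraMap_smul A (c k) x, map_smul, algebraMap_smul]

lemma backward [Module.Projective R M] 
    (H : DomdimGE R Aᵐᵒᵖ (Q →ₗ[R] R) 2 (ModuleCat.of Aᵐᵒᵖ (M →ₗ[R] R))) :
    Bijective (counit R A Q M) := by
  obtain ⟨T, hT, f, ⟨-, r, hr, hrf⟩, hext, T', hT', f', ⟨-, r', hr', hrf'⟩, -, -⟩ := H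
  change (M →ₗ[R] R) →ₗ[Aᵐᵒᵖ] T at f
  change T →+ (M →ₗ[R] R) at r
  change (T ⧸ LinearMap.range f) →ₗ[Aᵐᵒᵖ] T' at f'
  change T' →+ (T ⧸ LinearMap.range f) at r'
  obtain ⟨n, i, p, hpi⟩ := inAdd_iff hT
  obtain ⟨m, i', p', hpi'⟩ := inAdd_iff hT'
  obtain ⟨π, hπ⟩ := dualizeA (i ∘ₗ f)
  obtain ⟨ε, hε⟩ := dualizeA (i ∘ₗ p)
  obtain ⟨σ, hσ⟩ := dualizeA (i' ∘ₗ f' ∘ₗ (LinearMap.range f).mkQ ∘ₗ p)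
  obtain ⟨s, hs⟩ := dualizeR (A := A) (r.comp p.toAddMonoidHom) (fun c φ => by
    have h1 : p (algebraMap R Aᵐᵒᵖ c • φ) = algebraMap R Aᵐᵒᵖ c • p φ := map_smul p _ φ
    exact (congrArg r h1).trans (hr c _))
  -- the section `t` of the projection
  have hfr : ∀ z : T, z ∈ LinearMap.range f → z - f (r z) = 0 := by
    rintro _ ⟨φ, rfl⟩
    have : r (f φ) = φ := hrf φ
    rw [this, sub_self]
  let t : (T ⧸ LinearMap.range f) →+ T :=
    QuotientAddGroup.lift (LinearMap.range f).toAddSubgroup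
      (AddMonoidHom.id T - f.toAddMonoidHom.comp r) (fun z hz => hfr z hz)
  have ht : ∀ z : T, t ((LinearMap.range f).mkQ z) = z - f (r z) := fun z => rfl
  have htc : ∀ (c : R) (y : T ⧸ LinearMap.range f),
      t (algebraMap R Aᵐᵒᵖ c • y) = algebraMap R Aᵐᵒᵖ c • t y := by
    intro c y
    obtain ⟨z, rfl⟩ := Submodule.mkQ_surjective _ y
    rw [← map_smul, ht, ht, smul_sub, ← map_smul]
    exact congrArg (fun w => _ - f w) (hr c z)
  obtain ⟨τ, hτ⟩ := dualizeR (A := A)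
    ((i.toAddMonoidHom.comp t).comp (r'.comp p'.toAddMonoidHom)) (fun c φ => by
      have h1 : p' (algebraMap R Aᵐᵒᵖ c • φ) = algebraMap R Aᵐᵒᵖ c • p' φ := map_smul p' _ φ
      have h2 := (congrArg r' h1).trans (hr' c _)
      have h3 := (congrArg t h2).trans (htc c _)
      have h4 := (congrArg i h3).trans (map_smul i _ _)
      exact h4)
  have hπε : ∀ x, π (ε x) = π x := fun x => sep (R := R) fun φ => by
    rw [← hπ, ← hπ, ← hε]
    simp [hpi]
  have hπσ : ∀ x, π (σ x) = 0 := fun x => sep (R := R) fun φ => by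
    rw [← hπ, ← hσ]
    simp only [LinearMap.comp_apply, hpi]
    have : (LinearMap.range f).mkQ (f φ) = 0 := by
      rw [Submodule.mkQ_apply, Submodule.Quotient.mk_eq_zero]
      exact ⟨φ, rfl⟩
    rw [this]
    simp
  have hπs : ∀ x, π (s x) = x := fun x => sep (R := R) fun φ => by
    rw [← hπ, ← hs]
    show r (p (i (f φ))) x = φ x
    rw [hpi]
    exact LinearMap.congr_fun (hrf φ) x
  have hdec : ∀ x, ε x = s (π x) + σ (τ x) := fun x => sep (R := R) fun φ => by
    rw [map_add, ← hs, ← hπ, ← hσ, ← hτ, ← hε]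
    show i (p φ) x = i (f (r (p φ))) x +
      i (t (r' (p' (i' (f' ((LinearMap.range f).mkQ (p φ))))))) x
    rw [hpi']
    have : r' (f' ((LinearMap.range f).mkQ (p φ))) = (LinearMap.range f).mkQ (p φ) := hrf' _
    rw [this, ht, map_sub, LinearMap.sub_apply]
    ring
  refine alg_bij π (fun x => ⟨s x, hπs x⟩) ?_ (LinearMap.id - ε) ?_ σ hπσ ?_
  · intro g
    obtain ⟨h, hh⟩ := hext (dmap g)
    obtain ⟨k, hk⟩ := dualizeA (h ∘ₗ p)
    refine ⟨k, LinearMap.ext fun q => sep (R := R) fun φ => ?_⟩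
    rw [LinearMap.comp_apply, ← hπ, ← hk]
    show h (p (i (f φ))) q = _
    rw [hpi]
    exact LinearMap.congr_fun (hh φ) q
  · intro x
    simp [hπε]
  · intro x hx
    refine ⟨x, τ x, ?_⟩
    have := hdec x
    rw [hx, map_zero, zero_add] at this
    simp [← this]

lemma forward [Module.Projective R M] (H : Bijective (counit R A Q M)) :
    DomdimGE R Aᵐᵒᵖ (Q →ₗ[R] R) 2 (ModuleCat.of Aᵐᵒᵖ (M →ₗ[R] R)) := by
  obtain ⟨n, π, lift⟩ := exists_approx (R := R) (A := A) (Q := Q) M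
  have hsurj : Surjective π := by
    intro y
    obtain ⟨z, rfl⟩ := H.2 y
    obtain ⟨x, rfl⟩ := exists_Phi π lift z
    exact ⟨x, (counit_Phi π x).symm⟩
  obtain ⟨s, hs⟩ := Module.projective_lifting_property (π.restrictScalars R) LinearMap.id hsurj
  have hs : ∀ y, π (s y) = y := fun y => LinearMap.congr_fun hs y
  -- the kernel
  let K := LinearMap.ker π
  let pr : (Fin n → Q) →ₗ[R] K :=
    { toFun := fun x => ⟨x - s (π x), by simp [K, hs]⟩
      map_add' := fun x y => by
        ext1
        simp only [map_add, Submodule.coe_add]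
        abel
      map_smul' := fun c x => by
        ext1
        have : π (c • x) = c • π x := (π.restrictScalars R).map_smul c x
        simp only [this, map_smul, RingHom.id_apply]
        rw [← smul_sub]
        rfl }
  have hpr : ∀ x, ((pr x : K) : Fin n → Q) = x - s (π x) := fun x => rfl
  have hpr1 : ∀ x : K, pr x = x := fun x => by
    ext1
    rw [hpr, LinearMap.mem_ker.1 x.2, map_zero, sub_zero]
  have : Module.Finite R K := Module.Finite.of_surjective pr fun x => ⟨x, hpr1 x⟩
  have : Module.Projective R K := Module.Projective.of_split
    (K.subtype.restrictScalars R) pr (LinearMap.ext hpr1)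
  obtain ⟨m, σ', liftK⟩ := exists_approx (R := R) (A := A) (Q := Q) K
  have hσsurj : Surjective σ' := by
    intro x
    have := ker_gen π lift H.1 ((LinearMap.range σ').map K.subtype) (fun h hh q => by
      obtain ⟨k, hk⟩ := liftK (h.codRestrict K fun q => LinearMap.congr_fun hh q)
      exact ⟨σ' (k q), ⟨k q, rfl⟩, congrArg Subtype.val (LinearMap.congr_fun hk q)⟩) x x.2
    obtain ⟨y, ⟨z, rfl⟩, hy⟩ := this
    exact ⟨z, Subtype.ext hy⟩
  obtain ⟨s', hs'⟩ := Module.projective_lifting_property (σ'.restrictScalars R) LinearMap.id hσsurj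
  have hs' : ∀ y, σ' (s' y) = y := fun y => LinearMap.congr_fun hs' y
  let σ : (Fin m → Q) →ₗ[A] (Fin n → Q) := K.subtype ∘ₗ σ'
  have hπσ : ∀ z, π (σ z) = 0 := fun z => (σ' z).2
  let f : (M →ₗ[R] R) →ₗ[Aᵐᵒᵖ] ((Fin n → Q) →ₗ[R] R) := dmap π
  let f' : (((Fin n → Q) →ₗ[R] R) ⧸ LinearMap.range f) →ₗ[Aᵐᵒᵖ] ((Fin m → Q) →ₗ[R] R) :=
    Submodule.liftQ _ (dmap σ) (by
      rintro _ ⟨φ, rfl⟩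
      rw [LinearMap.mem_ker]
      refine LinearMap.ext fun z => ?_
      show φ (π (σ z)) = 0
      rw [hπσ, map_zero])
  have hf' : ∀ ψ, f' ((LinearMap.range f).mkQ ψ) = dmap σ ψ := fun ψ => rfl
  let r : ((Fin n → Q) →ₗ[R] R) →+ (M →ₗ[R] R) :=
    AddMonoidHom.mk' (fun ψ => ψ ∘ₗ s) (fun _ _ => rfl)
  have hr : ∀ φ, r (f φ) = φ := fun φ => LinearMap.ext fun x => congrArg φ (hs x)
  let ρ : ((Fin m → Q) →ₗ[R] R) →+ ((Fin n → Q) →ₗ[R] R) :=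
    AddMonoidHom.mk' (fun ω => ω ∘ₗ s' ∘ₗ pr) (fun _ _ => rfl)
  let r' : ((Fin m → Q) →ₗ[R] R) →+ (((Fin n → Q) →ₗ[R] R) ⧸ LinearMap.range f) :=
    (LinearMap.range f).mkQ.toAddMonoidHom.comp ρ
  have hr' : ∀ y, r' (f' y) = y := by
    intro y
    obtain ⟨ψ, rfl⟩ := Submodule.mkQ_surjective _ y
    rw [hf']
    show (LinearMap.range f).mkQ (ρ (dmap σ ψ)) = _
    rw [Submodule.mkQ_apply, Submodule.mkQ_apply, Submodule.Quotient.eq]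
    refine ⟨-(ψ ∘ₗ s), ?_⟩
    refine LinearMap.ext fun x => ?_
    show -(ψ (s (π x))) = ψ (σ' (s' (pr x)) : K) - ψ x
    rw [hs', hpr, map_sub]
    abel
  refine ⟨ModuleCat.of Aᵐᵒᵖ ((Fin n → Q) →ₗ[R] R), inAdd_dual n, f,
    ⟨(Function.LeftInverse.injective hr), r, ?_, hr⟩, ?_,
    ModuleCat.of Aᵐᵒᵖ ((Fin m → Q) →ₗ[R] R), inAdd_dual m, f',
    ⟨(Function.LeftInverse.injective hr'), r', ?_, hr'⟩, ?_, trivial⟩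
  · intro c ψ
    have h1 : r (c • ψ) = c • r ψ := rfl
    rw [← algMap_smul_dual (A := A), ← algMap_smul_dual (A := A)] at h1
    exact h1
  · intro g
    change (M →ₗ[R] R) →ₗ[Aᵐᵒᵖ] (Q →ₗ[R] R) at g
    obtain ⟨k, hk⟩ := dualizeA g
    obtain ⟨h, rfl⟩ := lift k
    exact ⟨dmap h, fun φ => LinearMap.ext fun q => (hk φ q).symm⟩
  · intro c ω
    have h1 : ρ (c • ω) = c • ρ ω := rfl
    rw [← algMap_smul_dual (A := A), ← algMap_smul_dual (A := A)] at h1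
    have h2 := (congrArg (LinearMap.range f).mkQ h1).trans (map_smul _ _ _)
    exact h2
  · intro g
    change (((Fin n → Q) →ₗ[R] R) ⧸ LinearMap.range f) →ₗ[Aᵐᵒᵖ] (Q →ₗ[R] R) at g
    obtain ⟨k, hk⟩ := dualizeA (g ∘ₗ (LinearMap.range f).mkQ)
    have hk0 : ∀ q, π (k q) = 0 := fun q => sep (R := R) fun φ => by
      have h1 := hk (f φ) q
      have h2 : (LinearMap.range f).mkQ (f φ) = 0 := by
        rw [Submodule.mkQ_apply, Submodule.Quotient.mk_eq_zero]
        exact ⟨φ, rfl⟩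
      rw [LinearMap.comp_apply, h2, map_zero] at h1
      rw [map_zero]
      exact h1.symm
    obtain ⟨h, hh⟩ := liftK (k.codRestrict K hk0)
    refine ⟨dmap h, fun y => ?_⟩
    obtain ⟨ψ, rfl⟩ := Submodule.mkQ_surjective (LinearMap.range f) y
    refine LinearMap.ext fun q => ?_
    have h1 : σ (h q) = k q := congrArg Subtype.val (LinearMap.congr_fun hh q)
    have h2 : g ((LinearMap.range f).mkQ ψ) q = ψ (k q) := hk ψ q
    exact (congrArg ψ h1).trans h2.symm

end Main

end RelDom4

section Stmt4

variable (R : Type u) [CommRing R] [IsNoetherianRing R]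
variable (A : Type u) [Ring A] [Algebra R A] [Module.Finite R A] [Module.Projective R A]
variable (Q : Type u) [AddCommGroup Q] [Module R Q] [Module A Q]
  [IsScalarTower R A Q] [SMulCommClass A R Q] [SMulCommClass R A Q]
  [Module.Finite A Q] [Module.Projective R Q]
variable (M : Type u) [AddCommGroup M] [Module R M] [Module A M]
  [IsScalarTower R A M] [SMulCommClass A R M] [SMulCommClass R A M]
  [Module.Finite A M] [Module.Projective R M]

/-- The counit `χ_M : Q ⊗_B Hom_A(Q, M) → M` is an isomorphism iff
`DQ-domdim_{(A,R)} DM ≥ 2`. -/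
theorem stmt_4
    (hQQ : Module.Projective R (TensorOver R A (Q →ₗ[R] R) Q)) :
    Bijective (counit R A Q M) ↔
      DomdimGE R Aᵐᵒᵖ (Q →ₗ[R] R) 2 (ModuleCat.of Aᵐᵒᵖ (M →ₗ[R] R)) := by
  have : Module.Finite R Q := Module.Finite.trans A Q
  have : Module.Finite R M := Module.Finite.trans A M
  exact ⟨RelDom4.forward, RelDom4.backward⟩

end Stmt4
end

section
/- Let R be a commutative Noetherian ring, A a projective Noetherian R-algebra, Q a finitely generated A-module projective over R with DQ ⊗_A Q projective over R, and B = End_A(Q)^op. For a finitely generated A-module M projective over R and integer n ≥ 2: Q-codomdim_{(A,R)} M ≥ n if and only if χ_M : Q ⊗_B Hom_A(Q, M) → M is an isomorphism and Tor_i^B(Q, Hom_A(Q, M)) = 0 for all 1 ≤ i ≤ n−2. -/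
universe u
open Function TensorProduct

namespace CodomProof

open RelDom

section Cplx

variable {A : Type u} [Ring A] {Q : Type u} [AddCommGroup Q] [Module A Q]

/-- The terms of the augmented complex `Hom_A(Q,M)^{k i}`, with `M` in degree `0`. -/
def Cx (A : Type u) [Ring A] (Q : Type u) [AddCommGroup Q] [Module A Q] (k : ℕ → ℕ)
    (M : Type u) [AddCommGroup M] [Module A M] : ℕ → Type u
  | 0 => M
  | i + 1 => Fin (k i) → (Q →ₗ[A] M)

instance cxGroup (k : ℕ → ℕ) (M : Type u) [AddCommGroup M] [Module A M] :
    ∀ i, AddCommGroup (Cx A Q k M i)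
  | 0 => inferInstanceAs (AddCommGroup M)
  | i + 1 => inferInstanceAs (AddCommGroup (Fin (k i) → (Q →ₗ[A] M)))

variable {k : ℕ → ℕ}
  (d : ∀ n, (Fin (k (n+1)) → Module.End A Q) →ₗ[Module.End A Q] (Fin (k n) → Module.End A Q))
  (ε : (Fin (k 0) → Module.End A Q) →ₗ[Module.End A Q] Q)

section
variable (M : Type u) [AddCommGroup M] [Module A M]

/-- augmentation -/
def aug : (Fin (k 0) → (Q →ₗ[A] M)) →+ M where
  toFun v := ∑ j, v j (ε (Pi.single j 1))
  map_zero' := by simp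
  map_add' v w := by simp [Finset.sum_add_distrib]

/-- `piMap` as an additive map -/
noncomputable def piHom {m n : ℕ}
    (e : (Fin m → Module.End A Q) →ₗ[Module.End A Q] (Fin n → Module.End A Q)) :
    (Fin m → (Q →ₗ[A] M)) →+ (Fin n → (Q →ₗ[A] M)) where
  toFun v := piMap (Module.End A Q) (Q →ₗ[A] M) e v
  map_zero' := by funext i; simp [piMap]
  map_add' v w := by funext i; simp [piMap, Finset.sum_add_distrib]

/-- differential -/
noncomputable def del : ∀ i, Cx A Q k M (i + 1) →+ Cx A Q k M i
  | 0 => aug ε M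
  | i + 1 => piHom M (d i)

/-- cycles -/
def Cyc : ∀ i, Cx A Q k M i → Prop
  | 0, _ => True
  | i + 1, v => del d ε M i v = 0

/-- exactness in a degree -/
def ExAt (i : ℕ) : Prop := ∀ v : Cx A Q k M i, Cyc d ε M i v → ∃ w, del d ε M i w = v

end

variable {M N : Type u} [AddCommGroup M] [Module A M] [AddCommGroup N] [Module A N]

/-- functoriality -/
def cmap (k : ℕ → ℕ) (f : M →ₗ[A] N) : ∀ i, Cx A Q k M i →+ Cx A Q k N i
  | 0 => f.toAddMonoidHom
  | i + 1 =>
    { toFun := fun (v : Fin (k i) → (Q →ₗ[A] M)) => (fun j => f ∘ₗ v j : Fin (k i) → (Q →ₗ[A] N))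
      map_zero' := by
        show (fun j => f ∘ₗ (0 : Q →ₗ[A] M) : Fin (k i) → (Q →ₗ[A] N)) = 0
        funext j; simp
      map_add' := fun v w => by
        show (fun j => f ∘ₗ ((v j : Q →ₗ[A] M) + w j) : Fin (k i) → (Q →ₗ[A] N)) =
          fun j => f ∘ₗ (v j : Q →ₗ[A] M) + f ∘ₗ (w j : Q →ₗ[A] M)
        funext j; exact LinearMap.comp_add _ _ _ }

lemma piHom_apply (M : Type u) [AddCommGroup M] [Module A M] {m n : ℕ}
    (e : (Fin m → Module.End A Q) →ₗ[Module.End A Q] (Fin n → Module.End A Q))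
    (v : Fin m → (Q →ₗ[A] M)) (i : Fin n) (q : Q) :
    (piHom M e v i) q = ∑ j, v j (e (Pi.single j 1) i q) := by
  show (∑ j, MulOpposite.op (e (Pi.single j 1) i) • v j) q = _
  rw [LinearMap.sum_apply]
  rfl

lemma cmap_del (f : M →ₗ[A] N) (i : ℕ) (v : Cx A Q k M (i+1)) :
    cmap k f i (del d ε M i v) = del d ε N i (cmap k f (i+1) v) := by
  cases i with
  | zero =>
    show f (∑ j, (v j : Q →ₗ[A] M) (ε (Pi.single j 1))) = ∑ j, f ((v j : Q →ₗ[A] M) (ε (Pi.single j 1)))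
    simp
  | succ i =>
    funext j
    refine LinearMap.ext fun q => ?_
    change Fin (k (i+1)) → (Q →ₗ[A] M) at v
    change f (piHom M (d i) v j q) = piHom N (d i) (fun j => f ∘ₗ v j) j q
    rw [piHom_apply, piHom_apply]
    simp

lemma cmap_comp {P : Type u} [AddCommGroup P] [Module A P] (g : N →ₗ[A] P) (f : M →ₗ[A] N)
    (i : ℕ) (v : Cx A Q k M i) : cmap k g i (cmap k f i v) = cmap k (g ∘ₗ f) i v := by
  cases i <;> rfl

lemma cmap_id (f : M →ₗ[A] M) (h : ∀ m, f m = m) (i : ℕ) (v : Cx A Q k M i) :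
    cmap k f i v = v := by
  cases i with
  | zero => exact h v
  | succ i => funext j; exact LinearMap.ext fun q => h _

lemma cyc_map (f : M →ₗ[A] N) (i : ℕ) (v : Cx A Q k M i) (h : Cyc d ε M i v) :
    Cyc d ε N i (cmap k f i v) := by
  cases i with
  | zero => trivial
  | succ i =>
    show del d ε N i _ = 0
    have h : del d ε M i v = 0 := h
    rw [← cmap_del, h, map_zero]

lemma cmap_inj (f : M →ₗ[A] N) (hf : Injective f) (i : ℕ) :
    Injective (cmap (Q := Q) k f i) := by
  cases i with
  | zero => exact hf
  | succ i =>
    intro v w h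
    funext j
    exact LinearMap.ext fun q => hf (LinearMap.congr_fun (congrFun h j) q)

lemma cyc_of_map (f : M →ₗ[A] N) (hf : Injective f) (i : ℕ) (v : Cx A Q k M i)
    (h : Cyc d ε N i (cmap k f i v)) : Cyc d ε M i v := by
  cases i with
  | zero => trivial
  | succ i =>
    have h : del d ε N i (cmap k f (i+1) v) = 0 := h
    show del d ε M i v = 0
    rw [← cmap_del] at h
    exact cmap_inj f hf i (by rw [h, map_zero])

lemma cmap_surj (f : M →ₗ[A] N) (hf : Surjective f)
    (hF : ∀ g : Q →ₗ[A] N, ∃ h : Q →ₗ[A] M, ∀ q, f (h q) = g q) (i : ℕ) :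
    Surjective (cmap (Q := Q) k f i) := by
  cases i with
  | zero => exact hf
  | succ i =>
    intro v
    choose h hh using hF
    exact ⟨fun j => h (v j), funext fun j => LinearMap.ext fun q => hh _ q⟩

lemma cmap_ker (f : M →ₗ[A] N) (i : ℕ) (v : Cx A Q k M i) (h : cmap k f i v = 0) :
    ∃ w : Cx A Q k (LinearMap.ker f) i, cmap k (LinearMap.ker f).subtype i w = v := by
  cases i with
  | zero => exact ⟨(⟨v, h⟩ : LinearMap.ker f), rfl⟩
  | succ i =>
    refine ⟨fun j => LinearMap.codRestrict _ (v j : Q →ₗ[A] M) fun q => ?_, ?_⟩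
    · exact LinearMap.congr_fun (congrFun h j) q
    · funext j; exact LinearMap.ext fun q => rfl

lemma cmap_ker_zero (f : M →ₗ[A] N) (i : ℕ) (w : Cx A Q k (LinearMap.ker f) i) :
    cmap k f i (cmap k (LinearMap.ker f).subtype i w) = 0 := by
  cases i with
  | zero => exact (w : LinearMap.ker f).2
  | succ i => funext j; exact LinearMap.ext fun q => ((w j : Q →ₗ[A] LinearMap.ker f) q).2

lemma sum_single {m : ℕ} {Y : Type u} [AddCommGroup Y] [Module (Module.End A Q) Y]
    (e : (Fin m → Module.End A Q) →ₗ[Module.End A Q] Y) (v : Fin m → Module.End A Q) :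
    e v = ∑ j, v j • e (Pi.single j 1) := by
  conv_lhs => rw [pi_eq_sum_univ' v]
  rw [map_sum]
  refine Finset.sum_congr rfl fun j _ => ?_
  rw [map_smul]

lemma aug_self (v : Fin (k 0) → Module.End A Q) : aug ε Q v = ε v := by
  rw [sum_single ε v]; rfl

lemma piHom_self {m n : ℕ}
    (e : (Fin m → Module.End A Q) →ₗ[Module.End A Q] (Fin n → Module.End A Q))
    (v : Fin m → Module.End A Q) : piHom Q e v = e v := by
  rw [sum_single e v]
  funext i
  refine LinearMap.ext fun q => ?_
  rw [piHom_apply, Finset.sum_apply, LinearMap.sum_apply]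
  rfl

/-- `d, ε` is a resolution -/
structure IsRes : Prop where
  surj : Surjective ε
  ex0 : LinearMap.ker ε = LinearMap.range (d 0)
  ex : ∀ n, LinearMap.ker (d n) = LinearMap.range (d (n+1))

variable {d ε}

lemma cyc_del (h : IsRes d ε) (M : Type u) [AddCommGroup M] [Module A M] (i : ℕ)
    (v : Cx A Q k M (i+1)) : Cyc d ε M i (del d ε M i v) := by
  match i, v with
  | 0, _ => trivial
  | 1, v =>
    change Fin (k 1) → (Q →ₗ[A] M) at v
    change ∑ i, (piHom M (d 0) v i) (ε (Pi.single i 1)) = 0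
    simp_rw [piHom_apply]
    rw [Finset.sum_comm]
    refine Finset.sum_eq_zero fun j _ => ?_
    rw [← map_sum]
    have := sum_single ε (d 0 (Pi.single j 1))
    have h2 : ε (d 0 (Pi.single j 1)) = 0 := by
      have : d 0 (Pi.single j 1) ∈ LinearMap.ker ε := h.ex0 ▸ ⟨_, rfl⟩
      exact this
    rw [h2] at this
    exact (congrArg (v j : Q →ₗ[A] M) this.symm).trans (map_zero _)
  | n + 2, v =>
    funext i
    refine LinearMap.ext fun q => ?_
    change Fin (k (n+2)) → (Q →ₗ[A] M) at v
    change (piHom M (d n) (piHom M (d (n+1)) v) i) q = 0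
    simp_rw [piHom_apply]
    rw [Finset.sum_comm]
    refine Finset.sum_eq_zero fun j _ => ?_
    rw [← map_sum]
    have := sum_single (d n) (d (n+1) (Pi.single j 1))
    have h2 : d n (d (n+1) (Pi.single j 1)) = 0 := by
      have : d (n+1) (Pi.single j 1) ∈ LinearMap.ker (d n) := (h.ex n) ▸ ⟨_, rfl⟩
      exact this
    rw [h2] at this
    have h3 := LinearMap.congr_fun (congrFun this.symm i) q
    rw [Finset.sum_apply, LinearMap.sum_apply] at h3
    exact (congrArg (v j : Q →ₗ[A] M) h3).trans (map_zero _)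

lemma exAt_self (h : IsRes d ε) (i : ℕ) : ExAt d ε Q i := by
  match i with
  | 0 =>
    intro v _
    obtain ⟨w, hw⟩ := h.surj v
    exact ⟨w, (aug_self ε w).trans hw⟩
  | 1 =>
    intro v hv
    have hv : v ∈ LinearMap.ker ε := (aug_self ε v).symm.trans hv
    rw [h.ex0] at hv
    obtain ⟨w, hw⟩ := hv
    exact ⟨w, (piHom_self _ w).trans hw⟩
  | n + 2 =>
    intro v hv
    have hv : v ∈ LinearMap.ker (d n) := (piHom_self _ v).symm.trans hv
    rw [h.ex n] at hv
    obtain ⟨w, hw⟩ := hv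
    exact ⟨w, (piHom_self _ w).trans hw⟩

lemma exAt_pi (h : IsRes d ε) (n i : ℕ) : ExAt d ε (Fin n → Q) i := by
  intro v hv
  have key : ∀ l : Fin n, ∃ w, del d ε Q i w = cmap k (LinearMap.proj l) i v := fun l =>
    exAt_self h i _ (cyc_map d ε _ i v hv)
  choose w hw using key
  refine ⟨∑ l, cmap k (LinearMap.single A (fun _ : Fin n => Q) l) (i+1) (w l), ?_⟩
  rw [map_sum]
  simp_rw [← cmap_del, hw, cmap_comp]
  cases i with
  | zero =>
    show ∑ l, Pi.single l ((v : Fin n → Q) l) = v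
    exact Finset.univ_sum_single (v : Fin n → Q)
  | succ i =>
    funext j
    refine LinearMap.ext fun q => ?_
    have : (∑ l, cmap (Q := Q) k (LinearMap.single A (fun _ : Fin n => Q) l ∘ₗ LinearMap.proj l) (i+1) v) j
       = ∑ l, (LinearMap.single A (fun _ : Fin n => Q) l ∘ₗ LinearMap.proj l) ∘ₗ
          (v j : Q →ₗ[A] (Fin n → Q)) := by
      exact Finset.sum_apply (M := fun _ : Fin (k i) => Q →ₗ[A] (Fin n → Q)) j Finset.univ
        (fun l => cmap (Q := Q) k (LinearMap.single A (fun _ : Fin n => Q) l ∘ₗ LinearMap.proj l) (i+1) v)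
    rw [this]
    rw [LinearMap.sum_apply]
    exact Finset.univ_sum_single ((v j : Q →ₗ[A] (Fin n → Q)) q)

lemma exAt_add (h : IsRes d ε) (T : Type u) [AddCommGroup T] [Module A T] (hT : InAdd A Q T)
    (i : ℕ) : ExAt d ε T i := by
  obtain ⟨n, a, p, hp⟩ := hT
  intro v hv
  obtain ⟨w, hw⟩ := exAt_pi h n i _ (cyc_map d ε a i v hv)
  refine ⟨cmap k p (i+1) w, ?_⟩
  rw [← cmap_del, hw, cmap_comp]
  exact cmap_id _ hp i v

lemma shift_up (h : IsRes d ε) (f : M →ₗ[A] N) (hf : Surjective f)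
    (hF : ∀ g : Q →ₗ[A] N, ∃ h : Q →ₗ[A] M, ∀ q, f (h q) = g q) (i : ℕ)
    (hM : ExAt d ε M (i+1)) (hK : ExAt d ε (LinearMap.ker f) i) : ExAt d ε N (i+1) := by
  intro m hm
  have hm : del d ε N i m = 0 := hm
  obtain ⟨t, rfl⟩ := cmap_surj f hf hF _ m
  rw [← cmap_del] at hm
  obtain ⟨κ, hκ⟩ := cmap_ker f i _ hm
  obtain ⟨κ', rfl⟩ := hK κ (cyc_of_map d ε _ Subtype.val_injective i κ
    (by rw [hκ]; exact cyc_del h M i t))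
  rw [cmap_del] at hκ
  obtain ⟨s, hs⟩ := hM (t - cmap k (LinearMap.ker f).subtype (i+1) κ') (by
    show del d ε M i _ = 0
    rw [map_sub, hκ, sub_self])
  refine ⟨cmap k f _ s, ?_⟩
  rw [← cmap_del, hs, map_sub, cmap_ker_zero, sub_zero]

lemma shift_down (h : IsRes d ε) (f : M →ₗ[A] N) (hf : Surjective f)
    (hF : ∀ g : Q →ₗ[A] N, ∃ h : Q →ₗ[A] M, ∀ q, f (h q) = g q) (i : ℕ)
    (hM : ExAt d ε M i) (hN : ExAt d ε N (i+1)) : ExAt d ε (LinearMap.ker f) i := by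
  intro κ hκ
  obtain ⟨t, ht⟩ := hM _ (cyc_map d ε (LinearMap.ker f).subtype i κ hκ)
  obtain ⟨m', hm'⟩ := hN (cmap k f (i+1) t) (by
    show del d ε N i _ = 0
    rw [← cmap_del, ht, cmap_ker_zero])
  obtain ⟨t', rfl⟩ := cmap_surj f hf hF _ m'
  rw [← cmap_del] at hm'
  obtain ⟨κ', hκ'⟩ := cmap_ker f (i+1) (t - del d ε M (i+1) t') (by rw [map_sub, hm', sub_self])
  refine ⟨κ', cmap_inj (LinearMap.ker f).subtype Subtype.val_injective i ?_⟩
  have h0 : del d ε M i (del d ε M (i+1) t') = 0 := cyc_del h M (i+1) t'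
  rw [cmap_del, hκ', map_sub, ht, h0, sub_zero]

/-- forward direction -/
lemma forward (R : Type u) [CommRing R] [Algebra R A] (h : IsRes d ε) (n : ℕ) :
    ∀ M : ModuleCat.{u} A, CodomdimGE R A Q n M → ∀ i < n, ExAt d ε M i := by
  induction n with
  | zero => intro M _ i hi; omega
  | succ n ih =>
    rintro M ⟨T, hT, f, ⟨hf, -⟩, hF, hK⟩ i hi
    cases i with
    | zero =>
      intro m _
      obtain ⟨t, rfl⟩ := hf m
      obtain ⟨w, hw⟩ := exAt_add h T hT 0 t trivial
      refine ⟨cmap k f 1 w, ?_⟩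
      rw [← cmap_del, hw]; rfl
    | succ i =>
      exact shift_up h f hf hF i (exAt_add h T hT _) (ih _ hK i (by omega))

end Cplx

section Back

variable (R : Type u) [CommRing R] [IsNoetherianRing R]
variable (A : Type u) [Ring A] [Algebra R A] [Module.Finite R A]
variable (Q : Type u) [AddCommGroup Q] [Module R Q] [Module A Q]
  [IsScalarTower R A Q] [SMulCommClass A R Q] [SMulCommClass R A Q]
  [Module.Finite A Q]

lemma noethHom (M : Type u) [AddCommGroup M] [Module R M] [Module A M]
    [IsScalarTower R A M] [SMulCommClass R A M] [SMulCommClass A R M] [Module.Finite R M] :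
    IsNoetherian R (Q →ₗ[A] M) := by
  have : Module.Finite R Q := Module.Finite.trans A Q
  obtain ⟨n, s, hs⟩ := Module.Finite.exists_fin (R := R) (M := Q)
  let e : (Q →ₗ[A] M) →ₗ[R] (Fin n → M) :=
    { toFun := fun g i => g (s i)
      map_add' := fun _ _ => rfl
      map_smul' := fun _ _ => rfl }
  refine isNoetherian_of_injective e ?_
  intro g g' hgg
  have : g.restrictScalars R = g'.restrictScalars R :=
    LinearMap.ext_on_range (v := s) hs fun i => congrFun hgg i
  exact LinearMap.ext fun q => LinearMap.congr_fun this q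

lemma exists_res (R : Type u) [CommRing R] [IsNoetherianRing R]
    (A : Type u) [Ring A] [Algebra R A] [Module.Finite R A]
    (Q : Type u) [AddCommGroup Q] [Module R Q] [Module A Q]
    [IsScalarTower R A Q] [SMulCommClass A R Q] [SMulCommClass R A Q]
    [Module.Finite A Q] : ∃ (k : ℕ → ℕ)
    (d : ∀ n, (Fin (k (n+1)) → Module.End A Q) →ₗ[Module.End A Q] (Fin (k n) → Module.End A Q))
    (ε : (Fin (k 0) → Module.End A Q) →ₗ[Module.End A Q] Q), IsRes d ε := by
  have : Module.Finite R Q := Module.Finite.trans A Q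
  have : IsNoetherian R (Module.End A Q) := noethHom R A Q Q
  have : IsNoetherianRing (Module.End A Q) := isNoetherian_of_tower R inferInstance
  have : Module.Finite (Module.End A Q) Q := Module.Finite.of_restrictScalars_finite R _ _
  obtain ⟨m, ε, hε⟩ := Module.Finite.exists_fin' (Module.End A Q) Q
  have step : ∀ x : (Σ m : ℕ, Submodule (Module.End A Q) (Fin m → Module.End A Q)),
      ∃ (n : ℕ) (g : (Fin n → Module.End A Q) →ₗ[Module.End A Q] (Fin x.1 → Module.End A Q)),
        LinearMap.range g = x.2 := by
    rintro ⟨m, N⟩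
    obtain ⟨n, s, hs⟩ := Submodule.fg_iff_exists_fin_generating_family.1 (IsNoetherian.noetherian N)
    exact ⟨n, Fintype.linearCombination _ s, by rw [Fintype.range_linearCombination, hs]⟩
  choose nn g hg using step
  let st : ℕ → (Σ m : ℕ, Submodule (Module.End A Q) (Fin m → Module.End A Q)) := fun i =>
    Nat.rec ⟨m, LinearMap.ker ε⟩ (fun _ x => ⟨nn x, LinearMap.ker (g x)⟩) i
  exact ⟨fun i => (st i).1, fun i => g (st i), ε, hε, (hg (st 0)).symm,
    fun n => (hg (st (n+1))).symm⟩

variable [Module.Projective R Q]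
variable {R A Q} {k : ℕ → ℕ}
  {d : ∀ n, (Fin (k (n+1)) → Module.End A Q) →ₗ[Module.End A Q] (Fin (k n) → Module.End A Q)}
  {ε : (Fin (k 0) → Module.End A Q) →ₗ[Module.End A Q] Q}

lemma backward (h : IsRes d ε) (n : ℕ) :
    ∀ (M : Type u) [AddCommGroup M] [Module R M] [Module A M]
      [IsScalarTower R A M] [SMulCommClass R A M] [SMulCommClass A R M] [Module.Finite R M]
      [Module.Projective R M], (∀ i < n, ExAt d ε M i) →
      CodomdimGE R A Q n (ModuleCat.of A M) := by
  induction n with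
  | zero => intros; trivial
  | succ n ih =>
    intro M _ _ _ _ _ _ _ _ hM
    have : Module.Finite R Q := Module.Finite.trans A Q
    have := noethHom R A Q M
    obtain ⟨m, s, hs⟩ := Module.Finite.exists_fin (R := R) (M := Q →ₗ[A] M)
    let f : (Fin m → Q) →ₗ[A] M := ∑ j, s j ∘ₗ LinearMap.proj j
    have hfa : ∀ v, f v = ∑ j, s j (v j) := fun v => by simp [f, LinearMap.sum_apply]
    have hF : ∀ g : Q →ₗ[A] M, ∃ h : Q →ₗ[A] (Fin m → Q), ∀ q, f (h q) = g q := by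
      intro g
      have : g ∈ Submodule.span R (Set.range s) := hs ▸ Submodule.mem_top
      obtain ⟨c, rfl⟩ := (Submodule.mem_span_range_iff_exists_fun R).1 this
      refine ⟨LinearMap.pi fun j => c j • LinearMap.id, fun q => ?_⟩
      rw [hfa, LinearMap.sum_apply]
      refine Finset.sum_congr rfl fun j _ => ?_
      show s j (c j • q) = c j • s j q
      exact (s j).map_smul_of_tower (c j) q
    have hf : Surjective f := by
      intro y
      obtain ⟨v, hv⟩ := hM 0 (by omega) y trivial
      choose l hl using hF
      have hv : ∑ j, (v j : Q →ₗ[A] M) (ε (Pi.single j 1)) = y := hv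
      refine ⟨∑ j, l (v j) (ε (Pi.single j 1)), ?_⟩
      rw [map_sum, ← hv]
      exact Finset.sum_congr rfl fun j _ => hl _ _
    obtain ⟨σ, hσ⟩ := Module.projective_lifting_property (f.restrictScalars R) LinearMap.id hf
    have hσ : ∀ x, f (σ x) = x := fun x => LinearMap.congr_fun hσ x
    have hadd : InAdd A Q (Fin m → Q) := ⟨m, LinearMap.id, LinearMap.id, fun _ => rfl⟩
    refine ⟨ModuleCat.of A (Fin m → Q), hadd, f, ⟨hf, σ.toAddMonoidHom, ?_, hσ⟩, hF, ?_⟩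
    · intro c x
      have hx : (algebraMap R A c • (x : M)) = c • (x : M) := algebraMap_smul A c (x : M)
      refine (congrArg σ hx).trans ?_
      refine (σ.map_smul c x).trans ?_
      exact (algebraMap_smul A c (σ x)).symm
    · have : Module.Finite R (LinearMap.ker f) :=
        Module.Finite.of_injective ((LinearMap.ker f).subtype.restrictScalars R)
          Subtype.val_injective
      have : Module.Projective R (LinearMap.ker f) := by
        let r : (Fin m → Q) →ₗ[R] LinearMap.ker f :=
          { toFun := fun x => ⟨x - σ (f x), by
              show f _ = 0
              rw [map_sub, hσ, sub_self]⟩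
            map_add' := fun x y => Subtype.ext (by simp; abel)
            map_smul' := fun c x => Subtype.ext (by
              show c • x - σ (f (c • x)) = c • (x - σ (f x))
              rw [f.map_smul_of_tower, map_smul, smul_sub]) }
        have : Module.Projective R (Fin m → Q) :=
          Module.Projective.of_equiv (DirectSum.linearEquivFunOnFintype R (Fin m) (fun _ => Q))
        refine Module.Projective.of_split ((LinearMap.ker f).subtype.restrictScalars R) r ?_
        refine LinearMap.ext fun x => Subtype.ext ?_
        show (x : Fin m → Q) - σ (f x) = x
        have : f x = 0 := x.2
        rw [this, map_zero, sub_zero]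
      exact ih (LinearMap.ker f) fun i hi =>
        shift_down h f hf hF i (exAt_add h _ hadd i) (hM _ (by omega))

end Back

section Counit

variable {R : Type u} [CommRing R]
variable {A : Type u} [Ring A] [Algebra R A]
variable {Q : Type u} [AddCommGroup Q] [Module R Q] [Module A Q]
  [IsScalarTower R A Q] [SMulCommClass A R Q] [SMulCommClass R A Q]
variable {M : Type u} [AddCommGroup M] [Module R M] [Module A M]
  [IsScalarTower R A M] [SMulCommClass A R M] [SMulCommClass R A M]
variable {k : ℕ → ℕ}
  {d : ∀ n, (Fin (k (n+1)) → Module.End A Q) →ₗ[Module.End A Q] (Fin (k n) → Module.End A Q)}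
  {ε : (Fin (k 0) → Module.End A Q) →ₗ[Module.End A Q] Q}

/-- the class of `q ⊗ g` -/
noncomputable def cls (R : Type u) [CommRing R] [Algebra R A] [Module R Q] [Module R M]
    [IsScalarTower R A Q] [SMulCommClass A R M] [SMulCommClass R A Q] [IsScalarTower R A M]
    [SMulCommClass R A M]
    (q : Q) (g : Q →ₗ[A] M) : CounitDom R A Q M :=
  Submodule.Quotient.mk (q ⊗ₜ[R] g)

lemma counit_cls (q : Q) (g : Q →ₗ[A] M) : counit R A Q M (cls R q g) = g q := by
  show counitAux R A Q M (q ⊗ₜ[R] g) = g q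
  simp [counitAux, evalHom]

lemma cls_bal (q : Q) (b : Module.End A Q) (g : Q →ₗ[A] M) :
    cls R (b q) g = cls R q (g ∘ₗ b) :=
  (Submodule.Quotient.eq _).2 (Submodule.subset_span ⟨q, b, g, rfl⟩)

lemma cls_add_left (q q' : Q) (g : Q →ₗ[A] M) : cls R (q + q') g = cls R q g + cls R q' g := by
  unfold cls; rw [TensorProduct.add_tmul]; rfl

lemma cls_add_right (q : Q) (g g' : Q →ₗ[A] M) : cls R q (g + g') = cls R q g + cls R q g' := by
  unfold cls; rw [TensorProduct.tmul_add]; rfl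

lemma cls_zero_right (q : Q) : cls R q (0 : Q →ₗ[A] M) = 0 := by
  unfold cls; rw [TensorProduct.tmul_zero]; rfl

lemma cls_zero_left (g : Q →ₗ[A] M) : cls R 0 g = 0 := by
  unfold cls; rw [TensorProduct.zero_tmul]; rfl

lemma cls_sum_left {ι : Type} (s : Finset ι) (q : ι → Q) (g : Q →ₗ[A] M) :
    cls R (∑ i ∈ s, q i) g = ∑ i ∈ s, cls R (q i) g :=
  map_sum (⟨⟨fun q => cls R q g, cls_zero_left g⟩, fun q q' => cls_add_left q q' g⟩ :
    Q →+ CounitDom R A Q M) q s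

lemma cls_sum_right {ι : Type} (s : Finset ι) (q : Q) (g : ι → (Q →ₗ[A] M)) :
    cls R q (∑ i ∈ s, g i) = ∑ i ∈ s, cls R q (g i) :=
  map_sum (⟨⟨fun g => cls R q g, cls_zero_right q⟩, fun g g' => cls_add_right q g g'⟩ :
    (Q →ₗ[A] M) →+ CounitDom R A Q M) g s

/-- the map `Hom(Q,M)^{k 0} → Q ⊗_B Hom(Q,M)` -/
noncomputable def toDom (R : Type u) [CommRing R] [Algebra R A] [Module R Q] [Module R M]
    [IsScalarTower R A Q] [SMulCommClass A R M] [SMulCommClass R A Q] [IsScalarTower R A M]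
    [SMulCommClass R A M] (ε : (Fin (k 0) → Module.End A Q) →ₗ[Module.End A Q] Q)
    (v : Fin (k 0) → (Q →ₗ[A] M)) : CounitDom R A Q M :=
  ∑ j, cls R (ε (Pi.single j 1)) (v j)

lemma counit_toDom (v : Fin (k 0) → (Q →ₗ[A] M)) :
    counit R A Q M (toDom R ε v) = aug ε M v := by
  unfold toDom
  rw [map_sum]
  exact Finset.sum_congr rfl fun j _ => counit_cls _ _

lemma cls_eq_toDom (w : Fin (k 0) → Module.End A Q) (g : Q →ₗ[A] M) :
    cls R (ε w) g = toDom R ε (fun j => g ∘ₗ w j) := by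
  rw [sum_single ε w, cls_sum_left]
  exact Finset.sum_congr rfl fun j _ => cls_bal _ _ _

lemma toDom_add (v w : Fin (k 0) → (Q →ₗ[A] M)) :
    toDom R ε (v + w) = toDom R ε v + toDom R ε w := by
  unfold toDom
  rw [← Finset.sum_add_distrib]
  exact Finset.sum_congr rfl fun j _ => cls_add_right _ _ _

lemma toDom_surj (h : IsRes d ε) : Surjective (toDom (M := M) R ε) := by
  intro x
  obtain ⟨x, rfl⟩ := Submodule.Quotient.mk_surjective _ x
  induction x with
  | zero => exact ⟨0, by unfold toDom; simp [cls_zero_right]⟩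
  | tmul q g =>
    obtain ⟨w, rfl⟩ := h.surj q
    exact ⟨_, (cls_eq_toDom w g).symm⟩
  | add x y hx hy =>
    obtain ⟨v, hv⟩ := hx
    obtain ⟨w, hw⟩ := hy
    exact ⟨v + w, by rw [toDom_add, hv, hw]; rfl⟩

lemma toDom_del (h : IsRes d ε) (w : Fin (k 1) → (Q →ₗ[A] M)) :
    toDom R ε (piHom M (d 0) w) = 0 := by
  have h1 : ∀ j, cls R (ε (d 0 (Pi.single j 1))) (w j) = 0 := fun j => by
    have : d 0 (Pi.single j 1) ∈ LinearMap.ker ε := h.ex0 ▸ ⟨_, rfl⟩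
    rw [LinearMap.mem_ker.1 this, cls_zero_left]
  have h2 : ∀ i, piHom M (d 0) w i = ∑ j, w j ∘ₗ d 0 (Pi.single j 1) i := fun i => rfl
  unfold toDom
  simp_rw [h2, cls_sum_right]
  rw [Finset.sum_comm]
  refine Finset.sum_eq_zero fun j _ => ?_
  rw [← h1 j, cls_eq_toDom]; rfl

lemma mk_comp_eq (h : IsRes d ε) (g : Q →ₗ[A] M) (w w' : Fin (k 0) → Module.End A Q)
    (hw : ε w = ε w') :
    (QuotientAddGroup.mk (fun j => g ∘ₗ w j) :
      (Fin (k 0) → (Q →ₗ[A] M)) ⧸ (piHom M (d 0)).range) =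
      QuotientAddGroup.mk (fun j => g ∘ₗ w' j) := by
  have h1 : -w + w' ∈ LinearMap.ker ε := by
    rw [LinearMap.mem_ker, map_add, map_neg, hw, neg_add_cancel]
  rw [h.ex0] at h1
  obtain ⟨u, hu⟩ := h1
  refine QuotientAddGroup.eq.2 ⟨fun j => g ∘ₗ u j, ?_⟩
  funext i
  refine LinearMap.ext fun q => ?_
  have h2 := LinearMap.congr_fun (congrFun ((piHom_self (d 0) u).trans hu) i) q
  have h3 := piHom_apply Q (d 0) u i q
  rw [piHom_apply]
  have h4 := congrArg g (h3.symm.trans h2)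
  rw [map_sum] at h4
  refine h4.trans ?_
  show g (-(w i q) + w' i q) = -(g (w i q)) + g (w' i q)
  rw [map_add, map_neg]

lemma exists_psi (R : Type u) [CommRing R] [Algebra R A] [Module R Q] [Module R M]
    [IsScalarTower R A Q] [SMulCommClass A R Q] [SMulCommClass R A Q]
    [IsScalarTower R A M] [SMulCommClass A R M] [SMulCommClass R A M] (h : IsRes d ε) :
    ∃ ψ : (Q ⊗[R] (Q →ₗ[A] M)) →+ (Fin (k 0) → (Q →ₗ[A] M)) ⧸ (piHom M (d 0)).range,
      ∀ (w : Fin (k 0) → Module.End A Q) (g : Q →ₗ[A] M),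
        ψ ((ε w) ⊗ₜ[R] g) = QuotientAddGroup.mk (fun j => g ∘ₗ w j) := by
  choose s hs using h.surj
  let F : Q →+ (Q →ₗ[A] M) →+ (Fin (k 0) → (Q →ₗ[A] M)) ⧸ (piHom M (d 0)).range :=
    AddMonoidHom.mk' (fun q => AddMonoidHom.mk'
      (fun g => QuotientAddGroup.mk (fun j => g ∘ₗ s q j))
      (fun g g' => by
        rw [← QuotientAddGroup.mk_add]; rfl))
      (fun q q' => by
        refine AddMonoidHom.ext fun g => ?_
        show (QuotientAddGroup.mk (fun j => g ∘ₗ s (q + q') j) :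
          (Fin (k 0) → (Q →ₗ[A] M)) ⧸ (piHom M (d 0)).range) =
          QuotientAddGroup.mk (fun j => g ∘ₗ s q j) + QuotientAddGroup.mk (fun j => g ∘ₗ s q' j)
        rw [mk_comp_eq h g (s (q + q')) (s q + s q') (by rw [map_add, hs, hs, hs]),
          ← QuotientAddGroup.mk_add]
        congr 1
        funext j
        exact LinearMap.comp_add _ _ _)
  refine ⟨TensorProduct.liftAddHom F ?_, ?_⟩
  · intro r q g
    show (QuotientAddGroup.mk (fun j => g ∘ₗ s (r • q) j) :
          (Fin (k 0) → (Q →ₗ[A] M)) ⧸ (piHom M (d 0)).range) =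
          QuotientAddGroup.mk (fun j => (r • g) ∘ₗ s q j)
    rw [mk_comp_eq h g (s (r • q)) (r • s q) (by rw [ε.map_smul_of_tower, hs, hs])]
    congr 1
    funext j
    refine LinearMap.ext fun x => ?_
    exact g.map_smul_of_tower r (s q j x)
  · intro w g
    rw [TensorProduct.liftAddHom_tmul]
    exact mk_comp_eq h g _ _ (hs _)

lemma exAt_one_of_inj (h : IsRes d ε) (hinj : Injective (counit R A Q M)) : ExAt d ε M 1 := by
  intro v hv
  change Fin (k 0) → (Q →ₗ[A] M) at v
  have hv : aug ε M v = 0 := hv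
  obtain ⟨ψ, hψ⟩ := exists_psi (M := M) R h
  have h0 : toDom R ε v = 0 := hinj (by rw [counit_toDom, hv, map_zero])
  have h1 : (∑ j, (ε (Pi.single j 1)) ⊗ₜ[R] v j) ∈ Submodule.span A (counitRel R A Q M) := by
    rw [← Submodule.Quotient.mk_eq_zero, ← h0]
    exact map_sum (Submodule.mkQ (Submodule.span A (counitRel R A Q M))) _ _
  have h2 : ∀ x ∈ Submodule.span A (counitRel R A Q M), ψ x = 0 := by
    intro x hx
    induction hx using Submodule.closure_induction with
    | zero => exact map_zero _
    | add x y _ _ hx hy => rw [map_add, hx, hy, add_zero]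
    | smul_mem a x hx =>
      obtain ⟨q, b, g, rfl⟩ := hx
      obtain ⟨w, hw⟩ := h.surj (a • q)
      have e1 : a • ((b q) ⊗ₜ[R] g - q ⊗ₜ[R] (g ∘ₗ b)) =
          (ε (b • w)) ⊗ₜ[R] g - (ε w) ⊗ₜ[R] (g ∘ₗ b) := by
        rw [smul_sub, TensorProduct.smul_tmul', TensorProduct.smul_tmul', map_smul, hw]
        congr 2
        exact (b.map_smul a q).symm
      rw [e1, map_sub, hψ, hψ, sub_eq_zero]
      rfl
  have h3 := h2 _ h1
  rw [map_sum] at h3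
  simp_rw [hψ] at h3
  have h4 : (QuotientAddGroup.mk v : (Fin (k 0) → (Q →ₗ[A] M)) ⧸ (piHom M (d 0)).range) = 0 := by
    rw [← h3]
    refine Eq.trans ?_ (map_sum (QuotientAddGroup.mk' (piHom M (d 0)).range) _ _)
    refine congrArg (QuotientAddGroup.mk' (piHom M (d 0)).range) ?_
    funext i
    rw [Finset.sum_apply, Finset.sum_eq_single i]
    · rw [Pi.single_eq_same]; rfl
    · intro j _ hj
      rw [Pi.single_eq_of_ne (Ne.symm hj)]
      exact LinearMap.comp_zero _
    · intro hi; exact absurd (Finset.mem_univ i) hi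
  exact (QuotientAddGroup.eq_zero_iff _).1 h4

lemma bij_iff (h : IsRes d ε) :
    Bijective (counit R A Q M) ↔ ExAt d ε M 0 ∧ ExAt d ε M 1 := by
  constructor
  · rintro ⟨hi, hs⟩
    refine ⟨fun y _ => ?_, exAt_one_of_inj h hi⟩
    obtain ⟨x, rfl⟩ := hs y
    obtain ⟨v, rfl⟩ := toDom_surj h x
    exact ⟨v, (counit_toDom v).symm⟩
  · rintro ⟨h0, h1⟩
    constructor
    · rw [injective_iff_map_eq_zero]
      intro x hx
      obtain ⟨v, rfl⟩ := toDom_surj h x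
      rw [counit_toDom] at hx
      obtain ⟨w, hw⟩ := h1 v hx
      have hw : piHom M (d 0) w = v := hw
      rw [← hw]
      exact toDom_del h _
    · intro y
      obtain ⟨v, hv⟩ := h0 y trivial
      exact ⟨toDom R ε v, (counit_toDom v).trans hv⟩

end Counit

end CodomProof

open RelDom Function TensorProduct

section Stmt5

variable (R : Type u) [CommRing R] [IsNoetherianRing R]
variable (A : Type u) [Ring A] [Algebra R A] [Module.Finite R A] [Module.Projective R A]
variable (Q : Type u) [AddCommGroup Q] [Module R Q] [Module A Q]
  [IsScalarTower R A Q] [SMulCommClass A R Q] [SMulCommClass R A Q]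
  [Module.Finite A Q] [Module.Projective R Q]
variable (M : Type u) [AddCommGroup M] [Module R M] [Module A M]
  [IsScalarTower R A M] [SMulCommClass A R M] [SMulCommClass R A M]
  [Module.Finite A M] [Module.Projective R M]

/-- For `n ≥ 2`: `Q-codomdim_{(A,R)} M ≥ n` iff the counit
`χ_M : Q ⊗_B Hom_A(Q,M) → M` is an isomorphism and `Tor_i^B(Q, Hom_A(Q,M)) = 0`
for `1 ≤ i ≤ n - 2`  (here `B = End_A(Q)ᵒᵖ`, and the Tor group is computed as
`Tor_i` over `E = End_A(Q)` of the right `E`-module `Hom_A(Q,M)` with the left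
`E`-module `Q`). -/
theorem stmt_5
    (hQQ : Module.Projective R (TensorOver R A (Q →ₗ[R] R) Q))
    (n : ℕ) (hn : 2 ≤ n) :
    CodomdimGE R A Q n (ModuleCat.of A M) ↔
      (Bijective (counit R A Q M) ∧
        TorVanishUpTo (Module.End A Q) (Q →ₗ[A] M) Q (n - 2)) := by
  have : Module.Finite R M := Module.Finite.trans A M
  constructor
  · intro hC
    obtain ⟨k, d, ε, h⟩ := CodomProof.exists_res R A Q
    have hE := CodomProof.forward R h n _ hC
    refine ⟨(CodomProof.bij_iff h).2 ⟨hE 0 (by omega), hE 1 (by omega)⟩,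
      k, d, ε, h.surj, h.ex0, h.ex, fun i hi v hv => ?_⟩
    exact hE (i + 2) (by omega) v hv
  · rintro ⟨hb, k, d, ε, h1, h2, h3, h4⟩
    have h : CodomProof.IsRes d ε := ⟨h1, h2, h3⟩
    obtain ⟨e0, e1⟩ := (CodomProof.bij_iff h).1 hb
    refine CodomProof.backward h n M fun i hi => ?_
    match i, hi with
    | 0, _ => exact e0
    | 1, _ => exact e1
    | i + 2, hi => exact fun v hv => h4 i (by omega) v hv

end Stmt5
end

section
/- Let R be a commutative Noetherian ring, A a projective Noetherian R-algebra, and Q a finitely generated A-module projective over R with DQ ⊗_A Q projective over R. Then the relative dominant dimensions satisfy DQ-domdim of the right regular module A_A equals Q-domdim of the left regular module A, i.e., DQ-domdim_{(A^op,R)} A = Q-codomdim_{(A,R)} DA = Q-domdim_{(A,R)} A. -/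
universe u
open Function TensorProduct

open RelDom Function TensorProduct


namespace RelDom

section Helpers

variable (R : Type u) [CommRing R] (A : Type u) [Ring A] [Algebra R A]

/-- Extending all linear forms along `f` gives an `R`-linear retraction. -/
lemma exists_retraction {M T : Type u} [AddCommGroup M] [AddCommGroup T] [Module R M] [Module R T]
    [Module.Finite R M] [Module.Projective R M] (f : M →ₗ[R] T)
    (h : ∀ l : M →ₗ[R] R, ∃ k : T →ₗ[R] R, ∀ m, k (f m) = l m) :
    ∃ r : T →ₗ[R] M, ∀ m, r (f m) = m := by
  obtain ⟨n, p, i, -, -, hpi⟩ := Module.Finite.exists_comp_eq_id_of_projective R M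
  choose k hk using fun j => h (LinearMap.proj j ∘ₗ i)
  refine ⟨p ∘ₗ LinearMap.pi k, fun m => ?_⟩
  have : LinearMap.pi k (f m) = i m := by
    ext j
    simpa using hk j m
  simp only [LinearMap.comp_apply, this]
  exact LinearMap.congr_fun hpi m

lemma rsplitMono_of_retraction {M T : Type u} [AddCommGroup M] [AddCommGroup T]
    [Module R M] [Module R T] [Module A M] [Module A T] [IsScalarTower R A M] [IsScalarTower R A T]
    (f : M →ₗ[A] T) (r : T →ₗ[R] M) (hr : ∀ m, r (f m) = m) : RSplitMono R A f :=
  ⟨Function.LeftInverse.injective hr, r.toAddMonoidHom, fun s x => by simp, hr⟩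

lemma projective_coker {M T : Type u} [AddCommGroup M] [AddCommGroup T]
    [Module R M] [Module R T] [Module A M] [Module A T] [IsScalarTower R A M] [IsScalarTower R A T]
    [Module.Projective R T]
    (f : M →ₗ[A] T) (r : T →ₗ[R] M) (hr : ∀ m, r (f m) = m) :
    Module.Projective R (T ⧸ LinearMap.range f) := by
  let e := Submodule.Quotient.restrictScalarsEquiv R (LinearMap.range f)
  let s : (T ⧸ (LinearMap.range f).restrictScalars R) →ₗ[R] T :=
    Submodule.liftQ _ (LinearMap.id - (f.restrictScalars R) ∘ₗ r) (by
      rintro x ⟨m, rfl⟩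
      simp [hr])
  refine Module.Projective.of_split (s ∘ₗ e.symm.toLinearMap)
    ((LinearMap.range f).mkQ.restrictScalars R) ?_
  refine LinearMap.ext fun x => ?_
  obtain ⟨x, rfl⟩ := Submodule.Quotient.mk_surjective _ x
  have : e.symm (Submodule.Quotient.mk x) = Submodule.Quotient.mk x := rfl
  simp only [LinearMap.comp_apply, LinearEquiv.coe_coe, this]
  show (LinearMap.range f).mkQ (x - f (r x)) = _
  have h0 : (LinearMap.range f).mkQ (f (r x)) = 0 :=
    (Submodule.Quotient.mk_eq_zero (LinearMap.range f)).2 (LinearMap.mem_range_self f (r x))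
  rw [map_sub, h0, sub_zero]
  rfl

lemma projective_pi (Q : Type u) [AddCommGroup Q] [Module R Q] [Module.Projective R Q] (m : ℕ) :
    Module.Projective R (Fin m → Q) :=
  Module.Projective.of_equiv (DirectSum.linearEquivFunOnFintype R (Fin m) (fun _ => Q))

lemma finite_hom {M N : Type u} [AddCommGroup M] [AddCommGroup N] [IsNoetherianRing R]
    [Module R M] [Module R N] [Module A M] [Module A N] [IsScalarTower R A M] [IsScalarTower R A N]
    [SMulCommClass A R N] [Module.Finite R M] [Module.Finite R N] [Module.Projective R M] :
    Module.Finite R (M →ₗ[A] N) := by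
  have : Module.Finite R (M →ₗ[R] N) := inferInstance
  refine Module.Finite.of_injective (LinearMap.restrictScalarsₗ R A M N R) ?_
  intro f g h
  ext x
  exact LinearMap.congr_fun h x

lemma sum_single' {Q : Type u} [AddCommGroup Q] [Module A Q] {n : ℕ} (v : Fin n → Q) :
    ∑ j, LinearMap.single A (fun _ : Fin n => Q) j (v j) = v :=
  LinearMap.sum_single_apply (fun _ => Q) v

lemma inAdd_pi (Q : Type u) [AddCommGroup Q] [Module A Q] (m : ℕ) : InAdd A Q (Fin m → Q) :=
  ⟨m, LinearMap.id, LinearMap.id, fun _ => rfl⟩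

lemma exists_left_approx {M Q : Type u} [AddCommGroup M] [AddCommGroup Q] [IsNoetherianRing R]
    [Module R M] [Module R Q] [Module A M] [Module A Q] [IsScalarTower R A M] [IsScalarTower R A Q]
    [SMulCommClass A R Q] [Module.Finite R M] [Module.Finite R Q] [Module.Projective R M] :
    ∃ (m : ℕ) (f : M →ₗ[A] (Fin m → Q)), ∀ g : M →ₗ[A] Q, ∃ h : (Fin m → Q) →ₗ[A] Q,
      ∀ x, h (f x) = g x := by
  have := finite_hom R A (M := M) (N := Q)
  obtain ⟨m, s, hs⟩ := Module.Finite.exists_fin (R := R) (M := M →ₗ[A] Q)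
  refine ⟨m, LinearMap.pi s, fun g => ?_⟩
  have hg : g ∈ Submodule.span R (Set.range s) := hs ▸ Submodule.mem_top
  obtain ⟨c, rfl⟩ := (Submodule.mem_span_range_iff_exists_fun R).1 hg
  refine ⟨∑ i, c i • LinearMap.proj i, fun x => ?_⟩
  simp [LinearMap.sum_apply]

lemma exists_right_approx {N Q : Type u} [AddCommGroup N] [AddCommGroup Q] [IsNoetherianRing R]
    [Module R N] [Module R Q] [Module A N] [Module A Q] [IsScalarTower R A N] [IsScalarTower R A Q]
    [SMulCommClass A R Q] [SMulCommClass A R N]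
    [Module.Finite R N] [Module.Finite R Q] [Module.Projective R Q] :
    ∃ (m : ℕ) (f : (Fin m → Q) →ₗ[A] N), ∀ g : Q →ₗ[A] N, ∃ h : Q →ₗ[A] (Fin m → Q),
      ∀ x, f (h x) = g x := by
  have := finite_hom R A (M := Q) (N := N)
  obtain ⟨m, s, hs⟩ := Module.Finite.exists_fin (R := R) (M := Q →ₗ[A] N)
  refine ⟨m, ∑ i, s i ∘ₗ LinearMap.proj i, fun g => ?_⟩
  have hg : g ∈ Submodule.span R (Set.range s) := hs ▸ Submodule.mem_top
  obtain ⟨c, rfl⟩ := (Submodule.mem_span_range_iff_exists_fun R).1 hg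
  refine ⟨LinearMap.pi fun i => c i • LinearMap.id, fun x => ?_⟩
  simp only [LinearMap.sum_apply, LinearMap.comp_apply, LinearMap.proj_apply, LinearMap.pi_apply,
    LinearMap.smul_apply, LinearMap.id_apply]
  refine Finset.sum_congr rfl fun i _ => ?_
  rw [← algebraMap_smul A (c i) x, map_smul, algebraMap_smul]

lemma domdimGE_equiv (Q : Type u) [AddCommGroup Q] [Module A Q] (n : ℕ) {M N : Type u}
    [AddCommGroup M] [AddCommGroup N] [Module A M] [Module A N] (e : N ≃ₗ[A] M)
    (h : DomdimGE R A Q n (ModuleCat.of A M)) : DomdimGE R A Q n (ModuleCat.of A N) := by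
  cases n with
  | zero => trivial
  | succ n =>
    obtain ⟨T, hT, f, ⟨hf, r, hr, hrf⟩, hap, hn⟩ := h
    let f' : N →ₗ[A] T := LinearMap.comp (M₂ := M) f e.toLinearMap
    refine ⟨T, hT, f', ⟨?_, e.symm.toLinearMap.toAddMonoidHom.comp r, ?_, ?_⟩, ?_, ?_⟩
    · exact hf.comp e.injective
    · intro s x
      show e.symm (r _) = _ • e.symm (r x)
      rw [hr]
      exact map_smul e.symm _ _
    · intro m
      show e.symm (r (f (e m))) = m
      rw [hrf]
      exact e.symm_apply_apply m
    · intro g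
      obtain ⟨k, hk⟩ := hap (g ∘ₗ e.symm.toLinearMap)
      refine ⟨k, fun m => (hk (e m)).trans ?_⟩
      show g (e.symm (e m)) = g m
      rw [e.symm_apply_apply]
    · have : LinearMap.range f' = LinearMap.range f :=
        LinearMap.range_comp_of_range_eq_top _ (LinearEquiv.range e)
      rw [this]
      exact hn

end Helpers

section HomVersion

variable (A : Type u) [Ring A] (Q : Type u) [AddCommGroup Q] [Module A Q]

/-- Every map `M → N` factors through a finite sum of copies of `Q`. -/
def FacHom (M N : Type u) [AddCommGroup M] [AddCommGroup N] [Module A M] [Module A N] : Prop :=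
  ∀ φ : M →ₗ[A] N, ∃ (m : ℕ) (a : M →ₗ[A] (Fin m → Q)) (b : (Fin m → Q) →ₗ[A] N),
    ∀ x, b (a x) = φ x

variable {A Q}
variable {M N T : Type u} [AddCommGroup M] [AddCommGroup N] [AddCommGroup T]
  [Module A M] [Module A N] [Module A T]

lemma ext_pi {f : M →ₗ[A] T}
    (hf : ∀ g : M →ₗ[A] Q, ∃ h : T →ₗ[A] Q, ∀ x, h (f x) = g x) {m : ℕ}
    (a : M →ₗ[A] (Fin m → Q)) : ∃ h : T →ₗ[A] (Fin m → Q), ∀ x, h (f x) = a x := by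
  choose h hh using fun j => hf (LinearMap.proj j ∘ₗ a)
  exact ⟨LinearMap.pi h, fun x => by ext j; simpa using hh j x⟩

lemma lift_pi {g : T →ₗ[A] N}
    (hg : ∀ k : Q →ₗ[A] N, ∃ h : Q →ₗ[A] T, ∀ x, g (h x) = k x) {m : ℕ}
    (b : (Fin m → Q) →ₗ[A] N) : ∃ h : (Fin m → Q) →ₗ[A] T, ∀ x, g (h x) = b x := by
  choose h hh using fun j => hg (b ∘ₗ LinearMap.single A (fun _ => Q) j)
  refine ⟨∑ j, h j ∘ₗ LinearMap.proj j, fun x => ?_⟩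
  simp only [LinearMap.sum_apply, map_sum, LinearMap.comp_apply, LinearMap.proj_apply, hh]
  rw [← map_sum]
  congr 1
  exact LinearMap.sum_single_apply (fun _ => Q) x

lemma FacHom.ext (H : FacHom A Q M N) {f : M →ₗ[A] T}
    (hf : ∀ g : M →ₗ[A] Q, ∃ h : T →ₗ[A] Q, ∀ x, h (f x) = g x) (φ : M →ₗ[A] N) :
    ∃ h : T →ₗ[A] N, ∀ x, h (f x) = φ x := by
  obtain ⟨m, a, b, hab⟩ := H φ
  obtain ⟨h, hh⟩ := ext_pi hf a
  exact ⟨b ∘ₗ h, fun x => by simp [hh, hab]⟩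

lemma FacHom.lift (H : FacHom A Q M N) {g : T →ₗ[A] N}
    (hg : ∀ k : Q →ₗ[A] N, ∃ h : Q →ₗ[A] T, ∀ x, g (h x) = k x) (φ : M →ₗ[A] N) :
    ∃ h : M →ₗ[A] T, ∀ x, g (h x) = φ x := by
  obtain ⟨m, a, b, hab⟩ := H φ
  obtain ⟨h, hh⟩ := lift_pi hg b
  exact ⟨h ∘ₗ a, fun x => by simp [hh, hab]⟩

lemma FacHom.of_ext (hT : InAdd A Q T) (f : M →ₗ[A] T)
    (H : ∀ φ : M →ₗ[A] N, ∃ h : T →ₗ[A] N, ∀ x, h (f x) = φ x) : FacHom A Q M N := by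
  intro φ
  obtain ⟨n, i, p, hip⟩ := hT
  obtain ⟨h, hh⟩ := H φ
  exact ⟨n, i ∘ₗ f, h ∘ₗ p, fun x => by simp [hip, hh]⟩

lemma FacHom.of_lift (hT : InAdd A Q T) (g : T →ₗ[A] N)
    (H : ∀ φ : M →ₗ[A] N, ∃ h : M →ₗ[A] T, ∀ x, g (h x) = φ x) : FacHom A Q M N := by
  intro φ
  obtain ⟨n, i, p, hip⟩ := hT
  obtain ⟨h, hh⟩ := H φ
  exact ⟨n, i ∘ₗ h, g ∘ₗ p, fun x => by simp [hip, hh]⟩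

section Shift
variable {T' : Type u} [AddCommGroup T'] [Module A T']
  (hT : InAdd A Q T) (hT' : InAdd A Q T')
  {f : M →ₗ[A] T'} (hf : ∀ g : M →ₗ[A] Q, ∃ h : T' →ₗ[A] Q, ∀ x, h (f x) = g x)
  {g : T →ₗ[A] N} (hg : ∀ k : Q →ₗ[A] N, ∃ h : Q →ₗ[A] T, ∀ x, g (h x) = k x)
include hT hT' hf hg

lemma facHom_ker (H : FacHom A Q (T' ⧸ LinearMap.range f) N) :
    FacHom A Q M (LinearMap.ker g) := by
  have hMT : FacHom A Q M T := FacHom.of_lift hT LinearMap.id fun φ => ⟨φ, fun _ => rfl⟩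
  refine FacHom.of_ext hT' f fun φ => ?_
  obtain ⟨ψ, hψ⟩ := hMT.ext hf ((LinearMap.ker g).subtype ∘ₗ φ)
  obtain ⟨θ, hθ⟩ := H.lift hg ((LinearMap.range f).liftQ (g ∘ₗ ψ) (by
    rintro _ ⟨m, rfl⟩
    simp [hψ]))
  refine ⟨LinearMap.codRestrict (LinearMap.ker g) (ψ - θ ∘ₗ (LinearMap.range f).mkQ) ?_, ?_⟩
  · intro x
    have := hθ (Submodule.Quotient.mk x)
    simp only [Submodule.liftQ_apply, LinearMap.comp_apply] at this
    simp [this]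
  · intro x
    have : (Submodule.Quotient.mk (f x) : T' ⧸ LinearMap.range f) = 0 :=
      (Submodule.Quotient.mk_eq_zero _).2 ⟨_, rfl⟩
    apply Subtype.ext
    show ψ (f x) - θ (Submodule.Quotient.mk (f x)) = φ x
    rw [this, map_zero, sub_zero, hψ]
    rfl

lemma facHom_coker (H : FacHom A Q M (LinearMap.ker g)) :
    FacHom A Q (T' ⧸ LinearMap.range f) N := by
  have hTN : FacHom A Q T' N := FacHom.of_ext hT' LinearMap.id fun φ => ⟨φ, fun _ => rfl⟩
  refine FacHom.of_lift hT g fun φ => ?_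
  obtain ⟨ψ, hψ⟩ := hTN.lift hg (φ ∘ₗ (LinearMap.range f).mkQ)
  have h0 : ∀ x, (Submodule.Quotient.mk (f x) : T' ⧸ LinearMap.range f) = 0 := fun x =>
      (Submodule.Quotient.mk_eq_zero _).2 ⟨_, rfl⟩
  obtain ⟨θ, hθ⟩ := H.ext hf (LinearMap.codRestrict (LinearMap.ker g) (ψ ∘ₗ f) (fun x => by
    simp [hψ, h0]))
  refine ⟨(LinearMap.range f).liftQ (ψ - (LinearMap.ker g).subtype ∘ₗ θ) ?_, ?_⟩
  · rintro _ ⟨m, rfl⟩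
    simp [hθ]
  · intro x
    obtain ⟨x, rfl⟩ := Submodule.Quotient.mk_surjective _ x
    simp [hψ]

end Shift

variable (A Q)

/-- Chain of factorisation properties along right approximations. -/
def CodS (M : Type u) [AddCommGroup M] [Module A M] : ℕ → ModuleCat.{u} A → Prop
  | 0, _ => True
  | n + 1, N => FacHom A Q M N ∧
      ∃ (T : ModuleCat.{u} A) (_ : InAdd A Q T) (g : T →ₗ[A] N),
        (∀ k : Q →ₗ[A] (N : Type u), ∃ h : Q →ₗ[A] (T : Type u), ∀ q, g (h q) = k q) ∧
        CodS M n (ModuleCat.of A (LinearMap.ker g))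

/-- Chain of factorisation properties along left approximations. -/
def DomS (N : Type u) [AddCommGroup N] [Module A N] : ℕ → ModuleCat.{u} A → Prop
  | 0, _ => True
  | n + 1, M => FacHom A Q M N ∧
      ∃ (T : ModuleCat.{u} A) (_ : InAdd A Q T) (f : M →ₗ[A] T),
        (∀ k : (M : Type u) →ₗ[A] Q, ∃ h : (T : Type u) →ₗ[A] Q, ∀ q, h (f q) = k q) ∧
        DomS N n (ModuleCat.of A ((T : Type u) ⧸ LinearMap.range f))

variable {A Q}

lemma CodS.shift {T' : Type u} [AddCommGroup T'] [Module A T'] (hT' : InAdd A Q T')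
    {f : M →ₗ[A] T'} (hf : ∀ g : M →ₗ[A] Q, ∃ h : T' →ₗ[A] Q, ∀ x, h (f x) = g x) (n : ℕ) :
    ∀ N : ModuleCat.{u} A, CodS A Q M (n + 1) N → CodS A Q (T' ⧸ LinearMap.range f) n N := by
  induction n with
  | zero => intros; trivial
  | succ n ih =>
    rintro N ⟨-, T, hT, g, hg, h⟩
    exact ⟨facHom_coker hT hT' hf hg h.1, T, hT, g, hg, ih _ h⟩

lemma DomS.shift (hT : InAdd A Q T)
    {g : T →ₗ[A] N} (hg : ∀ k : Q →ₗ[A] N, ∃ h : Q →ₗ[A] T, ∀ x, g (h x) = k x) (n : ℕ) :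
    ∀ M : ModuleCat.{u} A, DomS A Q N (n + 1) M → DomS A Q (LinearMap.ker g) n M := by
  induction n with
  | zero => intros; trivial
  | succ n ih =>
    rintro N ⟨-, T, hT', f, hf, h⟩
    exact ⟨facHom_ker hT hT' hf hg h.1, T, hT', f, hf, ih _ h⟩

variable (R : Type u) [CommRing R] [Algebra R A]

lemma codS_of_codomdimGE (n : ℕ) : ∀ N : ModuleCat.{u} A,
    CodomdimGE R A Q n N → CodS A Q A n N := by
  induction n with
  | zero => intros; trivial
  | succ n ih =>
    rintro N ⟨T, hT, g, hg, hap, h⟩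
    refine ⟨FacHom.of_lift hT g fun φ => ?_, T, hT, g, hap, ih _ h⟩
    obtain ⟨t, ht⟩ := hg.1 (φ 1)
    refine ⟨LinearMap.toSpanSingleton A T t, fun x => ?_⟩
    rw [LinearMap.toSpanSingleton_apply, map_smul, ht, ← map_smul, smul_eq_mul, mul_one]

lemma domS_of_domdimGE (n : ℕ) : ∀ M : ModuleCat.{u} A,
    DomdimGE R A Q n M → DomS A Q (A →ₗ[R] R) n M := by
  induction n with
  | zero => intros; trivial
  | succ n ih =>
    rintro M ⟨T, hT, f, ⟨-, r, hr, hrf⟩, hap, h⟩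
    refine ⟨FacHom.of_ext hT f fun φ => ?_, T, hT, f, hap, ih _ h⟩
    refine ⟨{ toFun := fun t =>
                { toFun := fun a => φ (r (a • t)) 1
                  map_add' := fun a b => by rw [add_smul, map_add, map_add, LinearMap.add_apply]
                  map_smul' := fun s a => by
                    rw [Algebra.smul_def, mul_smul, hr, map_smul, coind_smul_apply,
                      RingHom.id_apply, one_mul, Algebra.algebraMap_eq_smul_one, map_smul] }
              map_add' := fun t t' => LinearMap.ext fun a => by
                show φ (r (a • (t + t'))) 1 = φ (r (a • t)) 1 + φ (r (a • t')) 1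
                rw [smul_add, map_add, map_add, LinearMap.add_apply]
              map_smul' := fun c t => LinearMap.ext fun a => by
                show φ (r (a • c • t)) 1 = φ (r ((a * c) • t)) 1
                rw [mul_smul] }, fun x => LinearMap.ext fun a => ?_⟩
    show φ (r (a • f x)) 1 = φ x a
    rw [← map_smul, hrf, map_smul, coind_smul_apply, one_mul]

variable [IsNoetherianRing R] [Module R Q] [IsScalarTower R A Q]
  [SMulCommClass A R Q] [Module.Finite R Q] [Module.Projective R Q]

lemma domdimGE_of_codS (n : ℕ) : ∀ (M : Type u) [AddCommGroup M] [Module R M] [Module A M]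
    [IsScalarTower R A M] [Module.Finite R M] [Module.Projective R M],
    CodS A Q M n (ModuleCat.of A (A →ₗ[R] R)) → DomdimGE R A Q n (ModuleCat.of A M) := by
  induction n with
  | zero => intros; trivial
  | succ n ih =>
    intro M _ _ _ _ _ _ H
    obtain ⟨m, f, hf⟩ := exists_left_approx R A (M := M) (Q := Q)
    obtain ⟨r, hr⟩ := exists_retraction R (f.restrictScalars R) (fun l => by
      let φ : M →ₗ[A] (A →ₗ[R] R) :=
        { toFun := fun x => l ∘ₗ (LinearMap.toSpanSingleton A M x).restrictScalars R
          map_add' := fun x y => LinearMap.ext fun a => by simp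
          map_smul' := fun c x => LinearMap.ext fun a => by
            show l (a • c • x) = l ((a * c) • x)
            rw [mul_smul] }
      have H1 : FacHom A Q M (A →ₗ[R] R) := H.1
      obtain ⟨h, hh⟩ := H1.ext hf φ
      refine ⟨{ toFun := fun t => h t 1
                map_add' := fun t t' => by rw [map_add, LinearMap.add_apply]
                map_smul' := fun s t => by
                  rw [← algebraMap_smul A s t, map_smul, coind_smul_apply,
                    RingHom.id_apply, one_mul, Algebra.algebraMap_eq_smul_one, map_smul] },
                fun x => ?_⟩
      show h (f x) 1 = l x
      rw [hh]
      show l ((1 : A) • x) = l x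
      rw [one_smul])
    have := projective_pi R Q m
    have := projective_coker R A f r hr
    exact ⟨ModuleCat.of A (Fin m → Q), inAdd_pi A Q m, f, rsplitMono_of_retraction R A f r hr, hf,
      ih _ (CodS.shift (inAdd_pi A Q m) hf n _ H)⟩

lemma codomdimGE_of_domS (n : ℕ) : ∀ (N : Type u) [AddCommGroup N] [Module R N] [Module A N]
    [IsScalarTower R A N] [SMulCommClass A R N] [Module.Finite R N] [Module.Projective R N],
    DomS A Q N n (ModuleCat.of A A) → CodomdimGE R A Q n (ModuleCat.of A N) := by
  induction n with
  | zero => intros; trivial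
  | succ n ih =>
    intro N _ _ _ _ _ _ _ H
    obtain ⟨m, g, hg⟩ := exists_right_approx R A (N := N) (Q := Q)
    have hs : Surjective g := by
      intro y
      have H1 : FacHom A Q A N := H.1
      obtain ⟨h, hh⟩ := H1.lift hg (LinearMap.toSpanSingleton A N y)
      exact ⟨h 1, by simp [hh]⟩
    obtain ⟨s, hs'⟩ := Module.projective_lifting_property (g.restrictScalars R)
      (LinearMap.id (R := R) (M := N)) hs
    have hs'' : ∀ y, g (s y) = y := fun y => LinearMap.congr_fun hs' y
    have : Module.Finite R (LinearMap.ker g) :=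
      Module.Finite.of_injective ((LinearMap.ker g).subtype.restrictScalars R)
        Subtype.val_injective
    have := projective_pi R Q m
    have : Module.Projective R (LinearMap.ker g) := by
      refine Module.Projective.of_split ((LinearMap.ker g).subtype.restrictScalars R)
        { toFun := fun x => (⟨x - s (g x), by simp [hs'']⟩ : LinearMap.ker g)
          map_add' := fun x y => by ext1; simp; abel
          map_smul' := fun c x => by
            ext1
            have : g (c • x) = c • g x := (g.restrictScalars R).map_smul c x
            simp [this, smul_sub] } ?_
      ext x
      simp
    refine ⟨ModuleCat.of A (Fin m → Q), inAdd_pi A Q m, g,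
      ⟨hs, s.toAddMonoidHom, fun c x => ?_, hs''⟩, hg, ih _ (DomS.shift (inAdd_pi A Q m) hg n _ H)⟩
    show s ((algebraMap R A c • x : N)) = (algebraMap R A c • s x : Fin m → Q)
    rw [algebraMap_smul, algebraMap_smul, map_smul]

end HomVersion

end RelDom

namespace RelDom

section Bilinear

variable {R : Type u} [CommRing R] {C C' : Type u} [Ring C] [Ring C'] [Algebra R C'] [Algebra R C]

/-- A balanced `R`-valued form on `M × X`, where `σ` turns `C'`-modules into right `C`-modules. -/
structure IsBal (σ : C → C') {M X : Type u} [AddCommGroup M] [AddCommGroup X]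
    [Module C M] [Module C' X] (b : M → X → R) : Prop where
  add_left : ∀ m m' x, b (m + m') x = b m x + b m' x
  add_right : ∀ m x x', b m (x + x') = b m x + b m x'
  smul_left : ∀ (r : R) m x, b (algebraMap R C r • m) x = r * b m x
  smul_right : ∀ (r : R) m x, b m (algebraMap R C' r • x) = r * b m x
  bal : ∀ c m x, b (c • m) x = b m (σ c • x)

namespace IsBal

variable {σ : C → C'} {M X Y Z : Type u} [AddCommGroup M] [AddCommGroup X]
    [Module C M] [Module C' X] [AddCommGroup Y] [Module C Y] [AddCommGroup Z] [Module C' Z]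
    {b b' : M → X → R}

lemma comp (h : IsBal σ b) (f : Y →ₗ[C] M) (g : Z →ₗ[C'] X) :
    IsBal σ (fun y z => b (f y) (g z)) where
  add_left m m' x := by rw [map_add, h.add_left]
  add_right m x x' := by rw [map_add, h.add_right]
  smul_left r m x := by rw [map_smul, h.smul_left]
  smul_right r m x := by rw [map_smul, h.smul_right]
  bal c m x := by rw [map_smul, map_smul, h.bal]

lemma sub (h : IsBal σ b) (h' : IsBal σ b') : IsBal σ (fun y z => b y z - b' y z) where
  add_left m m' x := by rw [h.add_left, h'.add_left]; ring
  add_right m x x' := by rw [h.add_right, h'.add_right]; ring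
  smul_left r m x := by rw [h.smul_left, h'.smul_left]; ring
  smul_right r m x := by rw [h.smul_right, h'.smul_right]; ring
  bal c m x := by rw [h.bal, h'.bal]

lemma sum {n : ℕ} {B : Fin n → M → X → R} (h : ∀ i, IsBal σ (B i)) :
    IsBal σ (fun y z => ∑ i, B i y z) where
  add_left m m' x := by
    rw [← Finset.sum_add_distrib]; exact Finset.sum_congr rfl fun i _ => (h i).add_left _ _ _
  add_right m x x' := by
    rw [← Finset.sum_add_distrib]; exact Finset.sum_congr rfl fun i _ => (h i).add_right _ _ _
  smul_left r m x := by
    rw [Finset.mul_sum]; exact Finset.sum_congr rfl fun i _ => (h i).smul_left _ _ _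
  smul_right r m x := by
    rw [Finset.mul_sum]; exact Finset.sum_congr rfl fun i _ => (h i).smul_right _ _ _
  bal c m x := Finset.sum_congr rfl fun i _ => (h i).bal _ _ _

lemma zero_left (h : IsBal σ b) (x : X) : b 0 x = 0 := by
  have := h.add_left 0 0 x
  simpa using this

lemma zero_right (h : IsBal σ b) (m : M) : b m 0 = 0 := by
  have := h.add_right m 0 0
  simpa using this

lemma sub_left (h : IsBal σ b) (m m' : M) (x : X) : b (m - m') x = b m x - b m' x := by
  have := h.add_left (m - m') m' x
  rw [sub_add_cancel] at this
  rw [this]; ring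

lemma sub_right (h : IsBal σ b) (m : M) (x x' : X) : b m (x - x') = b m x - b m x' := by
  have := h.add_right m (x - x') x'
  rw [sub_add_cancel] at this
  rw [this]; ring

lemma sum_right (h : IsBal σ b) (m : M) {n : ℕ} (x : Fin n → X) :
    b m (∑ i, x i) = ∑ i, b m (x i) :=
  map_sum (AddMonoidHom.mk' (b m) (h.add_right m)) x _

lemma sum_left (h : IsBal σ b) (x : X) {n : ℕ} (m : Fin n → M) :
    b (∑ i, m i) x = ∑ i, b (m i) x :=
  map_sum (AddMonoidHom.mk' (fun m => b m x) (fun m m' => h.add_left m m' x)) m _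

lemma quot_left (h : IsBal σ b) (p : Submodule C M) (hp : ∀ m ∈ p, ∀ x, b m x = 0) :
    ∃ c : M ⧸ p → X → R, IsBal σ c ∧ ∀ m x, c (Submodule.Quotient.mk m) x = b m x := by
  have key : ∀ m m', (Submodule.Quotient.mk m : M ⧸ p) = Submodule.Quotient.mk m' →
      ∀ x, b m x = b m' x := by
    intro m m' e x
    have := hp _ ((Submodule.Quotient.eq p).1 e) x
    rw [h.sub_left] at this
    exact sub_eq_zero.1 this
  have hs := Submodule.Quotient.mk_surjective p
  have hc : ∀ m x, b (Function.surjInv hs (Submodule.Quotient.mk m)) x = b m x := fun m x =>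
    key _ _ (Function.surjInv_eq hs _) x
  refine ⟨fun q x => b (Function.surjInv hs q) x, ⟨?_, ?_, ?_, ?_, ?_⟩, hc⟩
  · intro m m' x
    obtain ⟨m, rfl⟩ := hs m
    obtain ⟨m', rfl⟩ := hs m'
    simp only [← Submodule.Quotient.mk_add, hc, h.add_left]
  · intro m x x'
    exact h.add_right _ _ _
  · intro r m x
    obtain ⟨m, rfl⟩ := hs m
    simp only [← Submodule.Quotient.mk_smul, hc, h.smul_left]
  · intro r m x
    exact h.smul_right _ _ _
  · intro c m x
    obtain ⟨m, rfl⟩ := hs m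
    simp only [← Submodule.Quotient.mk_smul, hc, h.bal]

lemma quot_right (h : IsBal σ b) (p : Submodule C' X) (hp : ∀ x ∈ p, ∀ m, b m x = 0) :
    ∃ c : M → X ⧸ p → R, IsBal σ c ∧ ∀ m x, c m (Submodule.Quotient.mk x) = b m x := by
  have key : ∀ x x', (Submodule.Quotient.mk x : X ⧸ p) = Submodule.Quotient.mk x' →
      ∀ m, b m x = b m x' := by
    intro x x' e m
    have := hp _ ((Submodule.Quotient.eq p).1 e) m
    rw [h.sub_right] at this
    exact sub_eq_zero.1 this
  have hs := Submodule.Quotient.mk_surjective p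
  have hc : ∀ m x, b m (Function.surjInv hs (Submodule.Quotient.mk x)) = b m x := fun m x =>
    key _ _ (Function.surjInv_eq hs _) m
  refine ⟨fun m q => b m (Function.surjInv hs q), ⟨?_, ?_, ?_, ?_, ?_⟩, hc⟩
  · intro m m' x
    exact h.add_left _ _ _
  · intro m x x'
    obtain ⟨x, rfl⟩ := hs x
    obtain ⟨x', rfl⟩ := hs x'
    simp only [← Submodule.Quotient.mk_add, hc, h.add_right]
  · intro r m x
    exact h.smul_left _ _ _
  · intro r m x
    obtain ⟨x, rfl⟩ := hs x
    simp only [← Submodule.Quotient.mk_smul, hc, h.smul_right]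
  · intro c m x
    obtain ⟨x, rfl⟩ := hs x
    simp only [← Submodule.Quotient.mk_smul, hc, h.bal]

end IsBal

/-- A perfect balanced pairing. -/
structure IsPerf (σ : C → C') {Q Q' : Type u} [AddCommGroup Q] [AddCommGroup Q']
    [Module C Q] [Module C' Q'] (β : Q → Q' → R) : Prop extends IsBal σ β where
  inj_left : ∀ q, (∀ q', β q q' = 0) → q = 0
  inj_right : ∀ q', (∀ q, β q q' = 0) → q' = 0
  repr_left : ∀ l : Q' → R, (∀ x y, l (x + y) = l x + l y) →
    (∀ (r : R) x, l (algebraMap R C' r • x) = r * l x) → ∃ q, ∀ q', β q q' = l q'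
  repr_right : ∀ l : Q → R, (∀ x y, l (x + y) = l x + l y) →
    (∀ (r : R) x, l (algebraMap R C r • x) = r * l x) → ∃ q', ∀ q, β q q' = l q

section Perf

variable {σ : C → C'} (hσ : Surjective σ) {Q Q' : Type u} [AddCommGroup Q] [AddCommGroup Q']
    [Module C Q] [Module C' Q'] {β : Q → Q' → R} (hβ : IsPerf σ β)
    {M X T T' : Type u} [AddCommGroup M] [AddCommGroup X]
    [Module C M] [Module C' X] [AddCommGroup T] [Module C T] [AddCommGroup T'] [Module C' T']

include hβ

lemma IsPerf.ext_left {q q₂ : Q} (h : ∀ q', β q q' = β q₂ q') : q = q₂ :=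
  sub_eq_zero.1 (hβ.inj_left _ fun q' => by rw [hβ.sub_left, h, sub_self])

lemma IsPerf.ext_right {q q₂ : Q'} (h : ∀ q', β q' q = β q' q₂) : q = q₂ :=
  sub_eq_zero.1 (hβ.inj_right _ fun q' => by rw [hβ.sub_right, h, sub_self])

lemma IsPerf.map_left {b : M → Q' → R} (h : IsBal σ b) :
    ∃ φ : M →ₗ[C] Q, ∀ m q', b m q' = β (φ m) q' := by
  choose φ hφ using fun m => hβ.repr_left (b m) (h.add_right m) (fun r x => h.smul_right r m x)
  refine ⟨⟨⟨φ, fun m m' => hβ.ext_left fun q' => ?_⟩, fun c m => hβ.ext_left fun q' => ?_⟩,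
    fun m q' => (hφ m q').symm⟩
  · rw [hφ, hβ.add_left, hφ, hφ, h.add_left]
  · rw [RingHom.id_apply, hφ, hβ.bal, hφ, h.bal]

include hσ in
lemma IsPerf.map_right {b : Q → X → R} (h : IsBal σ b) :
    ∃ ψ : X →ₗ[C'] Q', ∀ q x, b q x = β q (ψ x) := by
  choose ψ hψ using fun x => hβ.repr_right (fun q => b q x) (fun q q' => h.add_left q q' x)
    (fun r q => h.smul_left r q x)
  refine ⟨⟨⟨ψ, fun m m' => hβ.ext_right fun q' => ?_⟩, fun c m => hβ.ext_right fun q' => ?_⟩,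
    fun m q' => (hψ q' m).symm⟩
  · rw [hψ, hβ.add_right, hψ, hψ, h.add_right]
  · obtain ⟨c, rfl⟩ := hσ c
    rw [RingHom.id_apply, hψ, ← hβ.bal, hψ, h.bal]

lemma IsPerf.add_left' (hT : InAdd C' Q' T') {b : M → T' → R} (h : IsBal σ b) :
    ∃ (n : ℕ) (φ : Fin n → M →ₗ[C] Q) (ψ : Fin n → T' →ₗ[C'] Q'),
      ∀ m t, b m t = ∑ i, β (φ i m) (ψ i t) := by
  obtain ⟨n, i, p, hip⟩ := hT
  choose φ hφ using fun j => hβ.map_left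
    (h.comp LinearMap.id (p ∘ₗ LinearMap.single C' (fun _ : Fin n => Q') j))
  refine ⟨n, φ, fun j => LinearMap.proj j ∘ₗ i, fun m t => ?_⟩
  simp only [← hφ, LinearMap.comp_apply, LinearMap.id_apply, LinearMap.proj_apply]
  rw [← h.sum_right, ← map_sum, sum_single', hip]

include hσ in
lemma IsPerf.add_right' (hT : InAdd C Q T) {b : T → X → R} (h : IsBal σ b) :
    ∃ (n : ℕ) (φ : Fin n → T →ₗ[C] Q) (ψ : Fin n → X →ₗ[C'] Q'),
      ∀ m t, b m t = ∑ i, β (φ i m) (ψ i t) := by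
  obtain ⟨n, i, p, hip⟩ := hT
  choose ψ hψ using fun j => hβ.map_right hσ
    (h.comp (p ∘ₗ LinearMap.single C (fun _ : Fin n => Q) j) LinearMap.id)
  refine ⟨n, fun j => LinearMap.proj j ∘ₗ i, ψ, fun m t => ?_⟩
  simp only [← hψ, LinearMap.comp_apply, LinearMap.id_apply, LinearMap.proj_apply]
  rw [← h.sum_left, ← map_sum, sum_single', hip]

omit hβ

/-- Every balanced form on `M × X` factors through finitely many copies of `β`. -/
def FacBil (σ : C → C') (β : Q → Q' → R) (M X : Type u) [AddCommGroup M] [AddCommGroup X]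
    [Module C M] [Module C' X] : Prop :=
  ∀ b : M → X → R, IsBal σ b → ∃ (n : ℕ) (φ : Fin n → M →ₗ[C] Q) (ψ : Fin n → X →ₗ[C'] Q'),
      ∀ m t, b m t = ∑ i, β (φ i m) (ψ i t)

include hσ hβ in
lemma facBil_shift (hT : InAdd C Q T) (hT' : InAdd C' Q' T')
    {f : M →ₗ[C] T} (hf : ∀ g : M →ₗ[C] Q, ∃ h : T →ₗ[C] Q, ∀ x, h (f x) = g x)
    {k : X →ₗ[C'] T'} (hk : ∀ g : X →ₗ[C'] Q', ∃ h : T' →ₗ[C'] Q', ∀ x, h (k x) = g x)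
    (H : FacBil σ β (T ⧸ LinearMap.range f) X) : FacBil σ β M (T' ⧸ LinearMap.range k) := by
  intro b hb
  have hf0 : ∀ x, (Submodule.Quotient.mk (f x) : T ⧸ LinearMap.range f) = 0 := fun x =>
    (Submodule.Quotient.mk_eq_zero _).2 ⟨_, rfl⟩
  have hk0 : ∀ x, (Submodule.Quotient.mk (k x) : T' ⧸ LinearMap.range k) = 0 := fun x =>
    (Submodule.Quotient.mk_eq_zero _).2 ⟨_, rfl⟩
  obtain ⟨n, φ, ψ, h1⟩ := hβ.add_left' hT' (hb.comp LinearMap.id (LinearMap.range k).mkQ)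
  choose φ' hφ' using fun j => hf (φ j)
  have hB : IsBal σ (fun t y => ∑ j, β (φ' j t) (ψ j y)) :=
    IsBal.sum fun j => hβ.toIsBal.comp (φ' j) (ψ j)
  have hB1 : ∀ m y, ∑ j, β (φ' j (f m)) (ψ j y) = b m (Submodule.Quotient.mk y) := fun m y => by
    simp only [hφ']
    exact (h1 m y).symm
  obtain ⟨c, hc, hc'⟩ := (hB.comp LinearMap.id k).quot_left (LinearMap.range f) (by
    rintro _ ⟨m, rfl⟩ x
    simp only [LinearMap.id_apply]
    rw [hB1, hk0, hb.zero_right])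
  obtain ⟨n₂, φ₂, ψ₂, h2⟩ := H c hc
  choose ψ' hψ' using fun j => hk (ψ₂ j)
  have hB' := hB.sub (IsBal.sum fun j =>
    hβ.toIsBal.comp (φ₂ j ∘ₗ (LinearMap.range f).mkQ) (ψ' j))
  obtain ⟨d, hd, hd'⟩ := hB'.quot_right (LinearMap.range k) (by
    rintro _ ⟨x, rfl⟩ t
    have e := hc' t x
    rw [h2] at e
    simp only [LinearMap.id_apply] at e
    simp only [LinearMap.comp_apply, hψ', Submodule.mkQ_apply]
    rw [← e, sub_self])
  obtain ⟨n₃, φ₃, ψ₃, h3⟩ := hβ.add_right' hσ hT hd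
  refine ⟨n₃, fun j => φ₃ j ∘ₗ f, ψ₃, fun m y => ?_⟩
  obtain ⟨y, rfl⟩ := Submodule.Quotient.mk_surjective _ y
  have e := h3 (f m) (Submodule.Quotient.mk y)
  rw [hd'] at e
  simp only [LinearMap.comp_apply, Submodule.mkQ_apply, hf0, map_zero, hβ.zero_left,
    Finset.sum_const_zero, sub_zero] at e
  rw [hB1] at e
  exact e

/-- Chain of factorisation properties along left approximations. -/
def BilS (σ : C → C') (β : Q → Q' → R) (X : Type u) [AddCommGroup X] [Module C' X] :
    ℕ → ModuleCat.{u} C → Prop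
  | 0, _ => True
  | n + 1, M => FacBil σ β M X ∧
      ∃ (T : ModuleCat.{u} C) (_ : InAdd C Q T) (f : M →ₗ[C] T),
        (∀ k : (M : Type u) →ₗ[C] Q, ∃ h : (T : Type u) →ₗ[C] Q, ∀ q, h (f q) = k q) ∧
        BilS σ β X n (ModuleCat.of C ((T : Type u) ⧸ LinearMap.range f))

include hσ hβ in
lemma BilS.shift (hT' : InAdd C' Q' T')
    {k : X →ₗ[C'] T'} (hk : ∀ g : X →ₗ[C'] Q', ∃ h : T' →ₗ[C'] Q', ∀ x, h (k x) = g x) (n : ℕ) :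
    ∀ M : ModuleCat.{u} C, BilS σ β X (n + 1) M → BilS σ β (T' ⧸ LinearMap.range k) n M := by
  induction n with
  | zero => intros; trivial
  | succ n ih =>
    rintro N ⟨-, T, hT, f, hf, h⟩
    exact ⟨facBil_shift hσ hβ hT hT' hf hk h.1, T, hT, f, hf, ih _ h⟩

include hσ hβ in
lemma bilS_of_domdimGE (n : ℕ) : ∀ M : ModuleCat.{u} C,
    DomdimGE R C Q n M → BilS σ β C' n M := by
  induction n with
  | zero => intros; trivial
  | succ n ih =>
    rintro M ⟨T, hT, f, ⟨-, r, hr, hrf⟩, hap, h⟩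
    refine ⟨fun b hb => ?_, T, hT, f, hap, ih _ h⟩
    obtain ⟨m, i, p, hip⟩ := hT
    choose q' hq' using fun j : Fin m => hβ.repr_right
      (fun q => b (r (p (LinearMap.single C (fun _ : Fin m => Q) j q))) 1)
      (fun x y => by rw [map_add, map_add, map_add, hb.add_left])
      (fun s x => by rw [map_smul, map_smul, hr, hb.smul_left])
    refine ⟨m, fun j => LinearMap.proj j ∘ₗ i ∘ₗ f,
      fun j => LinearMap.toSpanSingleton C' Q' (q' j), fun x c => ?_⟩
    obtain ⟨c, rfl⟩ := hσ c
    simp only [LinearMap.comp_apply, LinearMap.toSpanSingleton_apply, ← hβ.bal, LinearMap.proj_apply]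
    have e : ∀ j, c • i (f x) j = i (f (c • x)) j := fun j => by simp
    simp only [e, hq']
    rw [← hb.sum_left, ← map_sum, ← map_sum, sum_single', hip, hrf, hb.bal,
      smul_eq_mul, mul_one]

variable [IsNoetherianRing R] [Module R Q'] [IsScalarTower R C' Q']
  [SMulCommClass C' R Q'] [Module.Finite R Q'] [Module.Projective R Q']

include hσ hβ in
lemma domdimGE_of_bilS (h1 : σ 1 = 1) (hadd : ∀ c d, σ (c + d) = σ c + σ d)
    (hmul : ∀ c d, σ (c * d) = σ d * σ c) (halg : ∀ r, σ (algebraMap R C r) = algebraMap R C' r)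
    (n : ℕ) : ∀ (X : Type u) [AddCommGroup X] [Module R X] [Module C' X]
    [IsScalarTower R C' X] [Module.Finite R X] [Module.Projective R X],
    BilS σ β X n (ModuleCat.of C C) → DomdimGE R C' Q' n (ModuleCat.of C' X) := by
  induction n with
  | zero => intros; trivial
  | succ n ih =>
    intro X _ _ _ _ _ _ H
    obtain ⟨m, f, hf⟩ := exists_left_approx R C' (M := X) (Q := Q')
    obtain ⟨r, hr⟩ := exists_retraction R (f.restrictScalars R) (fun l => by
      have H1 : FacBil σ β C X := H.1
      obtain ⟨k, φ, ψ, h⟩ := H1 (fun c x => l (σ c • x))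
        { add_left := fun c d x => by rw [hadd, add_smul, map_add]
          add_right := fun c x y => by rw [smul_add, map_add]
          smul_left := fun s c x => by
            rw [smul_eq_mul, hmul, halg, mul_smul, algebraMap_smul, smul_comm, map_smul,
              smul_eq_mul]
          smul_right := fun s c x => by
            rw [algebraMap_smul, smul_comm, map_smul, smul_eq_mul]
          bal := fun c d x => by rw [smul_eq_mul, hmul, mul_smul] }
      choose ψ' hψ' using fun j => hf (ψ j)
      refine ⟨{ toFun := fun t => ∑ j, β (φ j 1) (ψ' j t)
                map_add' := fun t t' => by simp only [map_add, hβ.add_right, Finset.sum_add_distrib]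
                map_smul' := fun s t => by
                  simp only [← algebraMap_smul C' s t, map_smul, hβ.smul_right, RingHom.id_apply,
                    smul_eq_mul, Finset.mul_sum] }, fun x => ?_⟩
      have e := h 1 x
      rw [h1, one_smul] at e
      rw [e]
      simp [hψ'])
    have := projective_pi R Q' m
    have := projective_coker R C' f r hr
    exact ⟨ModuleCat.of C' (Fin m → Q'), inAdd_pi C' Q' m, f,
      rsplitMono_of_retraction R C' f r hr, hf,
      ih _ (BilS.shift hσ hβ (inAdd_pi C' Q' m) hf n _ H)⟩

end Perf

end Bilinear

end RelDom

namespace RelDom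

section Final

variable (R : Type u) [CommRing R] [IsNoetherianRing R]
variable (A : Type u) [Ring A] [Algebra R A] [Module.Finite R A] [Module.Projective R A]
variable (Q : Type u) [AddCommGroup Q] [Module R Q] [Module A Q]
  [IsScalarTower R A Q] [SMulCommClass A R Q]
  [Module.Finite R Q] [Module.Projective R Q]

lemma IsPerf.flip {R : Type u} [CommRing R] {C C' : Type u} [Ring C] [Ring C'] [Algebra R C]
    [Algebra R C'] {σ : C → C'} {τ : C' → C} (h : ∀ c, σ (τ c) = c) {Q Q' : Type u}
    [AddCommGroup Q] [AddCommGroup Q'] [Module C Q] [Module C' Q'] {β : Q → Q' → R}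
    (hβ : IsPerf σ β) : IsPerf τ (fun q' q => β q q') where
  add_left _ _ _ := hβ.add_right _ _ _
  add_right _ _ _ := hβ.add_left _ _ _
  smul_left _ _ _ := hβ.smul_right _ _ _
  smul_right _ _ _ := hβ.smul_left _ _ _
  bal c q' q := by rw [hβ.bal, h]
  inj_left := hβ.inj_right
  inj_right := hβ.inj_left
  repr_left := hβ.repr_right
  repr_right := hβ.repr_left

lemma isPerf_dual : IsPerf (R := R) (MulOpposite.op : A → Aᵐᵒᵖ)
    (fun (q : Q) (l : Q →ₗ[R] R) => l q) where
  add_left _ _ _ := map_add _ _ _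
  add_right _ _ _ := rfl
  smul_left r q l := by rw [algebraMap_smul, map_smul, smul_eq_mul]
  smul_right r q l := by
    rw [dual_smul_apply, MulOpposite.algebraMap_apply, MulOpposite.unop_op, algebraMap_smul,
      map_smul, smul_eq_mul]
  bal _ _ _ := rfl
  inj_left q h := (Module.forall_dual_apply_eq_zero_iff R q).1 h
  inj_right l h := LinearMap.ext h
  repr_left l hadd hsmul := by
    let l' : Module.Dual R (Module.Dual R Q) :=
      { toFun := l
        map_add' := hadd
        map_smul' := fun r x => by
          rw [RingHom.id_apply, smul_eq_mul, ← hsmul]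
          congr 1
          refine LinearMap.ext fun q => ?_
          rw [dual_smul_apply, MulOpposite.algebraMap_apply, MulOpposite.unop_op, algebraMap_smul,
            map_smul]
          rfl }
    obtain ⟨q, hq⟩ := (Module.bijective_dual_eval R Q).2 l'
    exact ⟨q, fun x => LinearMap.congr_fun hq x⟩
  repr_right l hadd hsmul :=
    ⟨{ toFun := l
       map_add' := hadd
       map_smul' := fun r x => by
        rw [RingHom.id_apply, smul_eq_mul, ← hsmul, algebraMap_smul] }, fun _ => rfl⟩

instance dualTower : IsScalarTower R Aᵐᵒᵖ (Q →ₗ[R] R) where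
  smul_assoc r a l := LinearMap.ext fun q => by
    rw [dual_smul_apply, LinearMap.smul_apply, dual_smul_apply, MulOpposite.unop_smul, smul_assoc,
      map_smul]

instance dualComm : SMulCommClass Aᵐᵒᵖ R (Q →ₗ[R] R) where
  smul_comm a r l := LinearMap.ext fun q => rfl

instance coindTower : IsScalarTower R A (A →ₗ[R] R) where
  smul_assoc r a l := LinearMap.ext fun q => by
    rw [coind_smul_apply, LinearMap.smul_apply, coind_smul_apply, mul_smul_comm,
      map_smul]

instance coindComm : SMulCommClass A R (A →ₗ[R] R) where
  smul_comm a r l := LinearMap.ext fun q => rfl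

/-- The right regular module. -/
def opEquiv : Aᵐᵒᵖ ≃ₗ[Aᵐᵒᵖ] A where
  toFun := MulOpposite.unop
  invFun := MulOpposite.op
  map_add' _ _ := rfl
  map_smul' _ _ := rfl
  left_inv _ := rfl
  right_inv _ := rfl

lemma op_iff (n : ℕ) : DomdimGE R Aᵐᵒᵖ (Q →ₗ[R] R) n (ModuleCat.of Aᵐᵒᵖ A) ↔
    DomdimGE R A Q n (ModuleCat.of A A) := by
  have hβ := isPerf_dual R A Q
  have hβ' : IsPerf (MulOpposite.unop : Aᵐᵒᵖ → A) (fun (l : Q →ₗ[R] R) q => l q) :=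
    hβ.flip (fun _ => rfl)
  constructor
  · intro h
    have h := domdimGE_equiv R Aᵐᵒᵖ _ n (opEquiv A) h
    exact domdimGE_of_bilS MulOpposite.unop_surjective hβ' rfl (fun _ _ => rfl) (fun _ _ => rfl)
      (fun _ => rfl) n A (bilS_of_domdimGE MulOpposite.unop_surjective hβ' n _ h)
  · intro h
    have : Module.Finite R Aᵐᵒᵖ := Module.Finite.equiv (MulOpposite.opLinearEquiv R)
    have : Module.Projective R Aᵐᵒᵖ := Module.Projective.of_equiv (MulOpposite.opLinearEquiv R)
    have : Module.Projective R (Q →ₗ[R] R) := inferInstanceAs (Module.Projective R (Module.Dual R Q))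
    refine domdimGE_equiv R Aᵐᵒᵖ _ n (opEquiv A).symm ?_
    exact domdimGE_of_bilS MulOpposite.op_surjective hβ rfl (fun _ _ => rfl) (fun _ _ => rfl)
      (fun _ => rfl) n Aᵐᵒᵖ (bilS_of_domdimGE MulOpposite.op_surjective hβ n _ h)

lemma cod_iff (n : ℕ) : CodomdimGE R A Q n (ModuleCat.of A (A →ₗ[R] R)) ↔
    DomdimGE R A Q n (ModuleCat.of A A) := by
  constructor
  · intro h
    exact domdimGE_of_codS R n A (codS_of_codomdimGE R n _ h)
  · intro h
    have : Module.Projective R (A →ₗ[R] R) := inferInstanceAs (Module.Projective R (Module.Dual R A))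
    exact codomdimGE_of_domS R n _ (domS_of_domdimGE R n _ h)

end Final

end RelDom

section Stmt6

variable (R : Type u) [CommRing R] [IsNoetherianRing R]
variable (A : Type u) [Ring A] [Algebra R A] [Module.Finite R A] [Module.Projective R A]
variable (Q : Type u) [AddCommGroup Q] [Module R Q] [Module A Q]
  [IsScalarTower R A Q] [SMulCommClass A R Q] [SMulCommClass R A Q]
  [Module.Finite A Q] [Module.Projective R Q]

/-- If `Q` is a finitely generated `A`-module, projective over `R`,
with `DQ ⊗_A Q` projective over `R`, then
`DQ-domdim_{(Aᵒᵖ,R)} A = Q-codomdim_{(A,R)} DA = Q-domdim_{(A,R)} A`,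
where `A` is the right regular module in the first term, `DA` the dual of the right
regular module (a left module) in the second, and `A` the left regular module in the
third. -/
theorem stmt_6
    (hQQ : Module.Projective R (TensorOver R A (Q →ₗ[R] R) Q)) :
    Domdim R Aᵐᵒᵖ (Q →ₗ[R] R) (ModuleCat.of Aᵐᵒᵖ A) =
        Codomdim R A Q (ModuleCat.of A (A →ₗ[R] R)) ∧
      Codomdim R A Q (ModuleCat.of A (A →ₗ[R] R)) =
        Domdim R A Q (ModuleCat.of A A) := by
  have : Module.Finite R Q := Module.Finite.trans A Q
  simp only [Domdim, Codomdim, op_iff R A Q, cod_iff R A Q, and_self]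

end Stmt6
end

section
/- Let R be a commutative Noetherian ring, A a projective Noetherian R-algebra, and Q a finitely generated A-module projective over R such that DQ ⊗_A Q is projective over R and Ext_A^i(Q, Q) = 0 for all i > 0. Suppose M is a finitely generated A-module, projective over R, with Ext_A^i(M, Q) = 0 for all i > 0. Then an exact sequence 0 → M → Q_1 → ... → Q_n witnesses Q-domdim_{(A,R)} M ≥ n if and only if each Q_i lies in add Q and the cokernel of Q_{n−1} → Q_n satisfies Ext_A^i(−, Q) = 0 for all i > 0 (and is projective over R). -/
universe u
open Function TensorProduct

namespace RelDom

section Helpers9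

open CategoryTheory

variable (R : Type u) [CommRing R] (A : Type u) [Ring A] [Algebra R A]

/-- Comparison of the two versions of `Ext` as far as vanishing is concerned. -/
lemma extVanish_iff (X Y : ModuleCat.{u} A) (n : ℕ) :
    ExtVanish A X Y (n + 1) ↔ ∀ x : Abelian.Ext.{u} X Y (n + 1), x = 0 := by
  let P := projectiveResolution X
  have h1 : ExtVanish A X Y (n + 1) ↔
      ∀ f : P.complex.X (n + 1) ⟶ Y, P.complex.d (n + 2) (n + 1) ≫ f = 0 →
        ∃ g : P.complex.X n ⟶ Y, P.complex.d (n + 1) n ≫ g = f := by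
    unfold ExtVanish
    rw [← ModuleCat.isZero_iff_subsingleton, (P.isoExt (R := ℤ) (n + 1) Y).isZero_iff,
      ← HomologicalComplex.exactAt_iff_isZero_homology,
      HomologicalComplex.exactAt_iff' _ n (n + 1) (n + 2) (by simp) (by simp),
      ShortComplex.moduleCat_exact_iff]
    rfl
  rw [h1]
  constructor
  · intro h x
    obtain ⟨f, hf, rfl⟩ := P.extMk_surjective x (n + 2) rfl
    rw [P.extMk_eq_zero_iff f (n + 2) rfl hf n rfl]
    exact h f hf
  · intro h f hf
    rw [← P.extMk_eq_zero_iff f (n + 2) rfl hf n rfl]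
    exact h _

/-- All positive Ext groups vanish. -/
def EV (X Y : Type u) [AddCommGroup X] [Module A X] [AddCommGroup Y] [Module A Y] : Prop :=
  ∀ i, 0 < i → ExtVanish A (ModuleCat.of A X) (ModuleCat.of A Y) i

variable {A}
variable {X Y Z : Type u} [AddCommGroup X] [Module A X] [AddCommGroup Y] [Module A Y]
  [AddCommGroup Z] [Module A Z]

lemma ev_iff : EV A X Y ↔ ∀ (n : ℕ)
    (x : Abelian.Ext.{u} (ModuleCat.of A X) (ModuleCat.of A Y) (n + 1)), x = 0 := by
  constructor
  · intro h n
    exact (extVanish_iff A _ _ n).1 (h (n + 1) (Nat.succ_pos n))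
  · rintro h (_ | n) hi
    · exact absurd hi (lt_irrefl _)
    · exact (extVanish_iff A _ _ n).2 (h n)

lemma ev_retract (h : EV A Z Y) (i : X →ₗ[A] Z) (p : Z →ₗ[A] X) (hip : ∀ x, p (i x) = x) :
    EV A X Y := by
  rw [ev_iff] at h ⊢
  intro n x
  have e : ModuleCat.ofHom i ≫ ModuleCat.ofHom p = 𝟙 (ModuleCat.of A X) := by
    ext y
    exact hip y
  rw [← Abelian.Ext.mk₀_id_comp x, ← e, ← Abelian.Ext.mk₀_comp_mk₀_assoc,
    h n ((Abelian.Ext.mk₀ _).comp x _), Abelian.Ext.comp_zero]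

lemma ev_pi (h : EV A X Y) (k : ℕ) : EV A (Fin k → X) Y := by
  rw [ev_iff] at h ⊢
  intro n x
  have e : ∑ j : Fin k, (ModuleCat.ofHom (LinearMap.proj (R := A) (φ := fun _ : Fin k => X) j) ≫
      ModuleCat.ofHom (LinearMap.single A (fun _ : Fin k => X) j)) =
        𝟙 (ModuleCat.of A (Fin k → X)) := by
    ext y
    simp [ModuleCat.hom_sum]
  rw [← Abelian.Ext.mk₀_id_comp x, ← e, Abelian.Ext.mk₀_sum, Abelian.Ext.sum_comp]
  refine Finset.sum_eq_zero fun j _ => ?_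
  rw [← Abelian.Ext.mk₀_comp_mk₀_assoc,
    h n ((Abelian.Ext.mk₀ _).comp x _), Abelian.Ext.comp_zero]

lemma ev_inAdd (h : EV A X Y) (hZ : InAdd A X Z) : EV A Z Y := by
  obtain ⟨n, i, p, hip⟩ := hZ
  exact ev_retract (ev_pi h n) i p hip

lemma subShortExact (N : Submodule A X) :
    (ShortComplex.mk (ModuleCat.ofHom N.subtype) (ModuleCat.ofHom N.mkQ)
      (by ext x; simp)).ShortExact where
  exact := by
    rw [ShortComplex.moduleCat_exact_iff_range_eq_ker]
    simp
  mono_f := (ModuleCat.mono_iff_injective _).2 N.injective_subtype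
  epi_g := (ModuleCat.epi_iff_surjective _).2 N.mkQ_surjective

lemma ev_quot (N : Submodule A X) (hX : EV A X Y) (hN : EV A N Y)
    (hom : ∀ h : N →ₗ[A] Y, ∃ H : X →ₗ[A] Y, H ∘ₗ N.subtype = h) : EV A (X ⧸ N) Y := by
  rw [ev_iff] at hX hN ⊢
  intro n x
  obtain ⟨y, rfl⟩ := Abelian.Ext.contravariant_sequence_exact₃ (subShortExact N) _ x
    (hX n _) (add_comm 1 n)
  cases n with
  | succ n => rw [hN n y]; exact Abelian.Ext.comp_zero ..
  | zero =>
    obtain ⟨g, rfl⟩ := (Abelian.Ext.mk₀_bijective _ _).2 y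
    obtain ⟨H, hH⟩ := hom g.hom
    have e : g = ModuleCat.ofHom N.subtype ≫ ModuleCat.ofHom H := by
      ext z
      exact (LinearMap.congr_fun hH z).symm
    rw [e, ← Abelian.Ext.mk₀_comp_mk₀]
    exact (subShortExact N).extClass_comp_assoc _

lemma ev_sub (N : Submodule A X) (hX : EV A X Y) (hN : EV A (X ⧸ N) Y) : EV A N Y := by
  rw [ev_iff] at hX hN ⊢
  intro n x
  obtain ⟨y, rfl⟩ := Abelian.Ext.contravariant_sequence_exact₁ (subShortExact N) _ x
    (add_comm 1 (n + 1)) (hN _ _)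
  rw [hX n y]
  exact Abelian.Ext.comp_zero ..

lemma hom_extend (N : Submodule A X) (hN : EV A (X ⧸ N) Y) (h : N →ₗ[A] Y) :
    ∃ H : X →ₗ[A] Y, H ∘ₗ N.subtype = h := by
  rw [ev_iff] at hN
  obtain ⟨y, hy⟩ := Abelian.Ext.contravariant_sequence_exact₁ (subShortExact N) _
    (Abelian.Ext.mk₀ (ModuleCat.ofHom h)) (add_comm 1 0) (hN _ _)
  obtain ⟨g, rfl⟩ := (Abelian.Ext.mk₀_bijective _ _).2 y
  rw [Abelian.Ext.mk₀_comp_mk₀] at hy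
  have := (Abelian.Ext.mk₀_bijective _ _).1 hy
  refine ⟨g.hom, LinearMap.ext fun z => ?_⟩
  exact congrArg (fun t => t.hom z) this

/-- Projectivity over `R` of an `A`-module. -/
def RProj (A : Type u) [Ring A] [Algebra R A] (X : Type u) [AddCommGroup X] [Module A X] : Prop :=
  Module.Projective R (RestrictScalars R A X)

variable {R}

/-- An additive map compatible with scalars of `R` as an `R`-linear map. -/
def toR (f : X →+ Z) (hf : ∀ (c : R) (x : X), f (algebraMap R A c • x) = algebraMap R A c • f x) :
    RestrictScalars R A X →ₗ[R] RestrictScalars R A Z where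
  toFun := f
  map_add' := f.map_add
  map_smul' c x := hf c x

lemma rproj_retract' (h : RProj R A Z) (i : X →+ Z)
    (hi : ∀ (c : R) (x : X), i (algebraMap R A c • x) = algebraMap R A c • i x)
    (p : Z →+ X)
    (hp : ∀ (c : R) (x : Z), p (algebraMap R A c • x) = algebraMap R A c • p x)
    (hip : ∀ x, p (i x) = x) : RProj R A X := by
  unfold RProj at *
  exact Module.Projective.of_split (toR i hi) (toR p hp) (LinearMap.ext hip)

lemma rproj_retract (h : RProj R A Z) (i : X →ₗ[A] Z) (p : Z →ₗ[A] X) (hip : ∀ x, p (i x) = x) :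
    RProj R A X :=
  rproj_retract' h i.toAddMonoidHom (fun _ _ => i.map_smul _ _) p.toAddMonoidHom
    (fun _ _ => p.map_smul _ _) hip

lemma rproj_of [Module R X] [IsScalarTower R A X] [Module.Projective R X] : RProj R A X := by
  unfold RProj
  let e : X ≃ₗ[R] RestrictScalars R A X :=
    { AddEquiv.refl X with
      map_smul' := fun c x => (algebraMap_smul A c x).symm }
  exact Module.Projective.of_equiv e

lemma rproj_inAdd [Module R X] [IsScalarTower R A X] [Module.Projective R X]
    (hZ : InAdd A X Z) : RProj R A Z := by
  obtain ⟨n, i, p, hip⟩ := hZ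
  have : Module.Projective R (Fin n → X) :=
    Module.Projective.of_equiv (DFinsupp.linearEquivFunOnFintype (R := R) (M := fun _ : Fin n => X))
  exact rproj_retract rproj_of i p hip

lemma rproj_quot (N : Submodule A X) (hX : RProj R A X) (hN : RSummand R A N) :
    RProj R A (X ⧸ N) := by
  obtain ⟨r, hr, hrN⟩ := hN
  let s : X →+ X := AddMonoidHom.id X - N.subtype.toAddMonoidHom.comp r
  have hs : ∀ x, s x = x - (r x : X) := fun x => rfl
  let i : X ⧸ N →+ X := QuotientAddGroup.lift N.toAddSubgroup s (by
    intro x hx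
    have := hrN ⟨x, hx⟩
    simp only at this
    simp [hs, this])
  have hi : ∀ x, i (N.mkQ x) = x - (r x : X) := fun x => rfl
  refine rproj_retract' hX i ?_ N.mkQ.toAddMonoidHom (fun _ _ => N.mkQ.map_smul _ _) ?_
  · intro c x
    obtain ⟨x, rfl⟩ := N.mkQ_surjective x
    rw [← map_smul, hi, hi, hr, smul_sub]
    rfl
  · intro x
    obtain ⟨x, rfl⟩ := N.mkQ_surjective x
    rw [hi]
    change N.mkQ (x - r x) = N.mkQ x
    simp

lemma rsummand_of_quot (N : Submodule A X) (hN : RProj R A (X ⧸ N)) : RSummand R A N := by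
  unfold RProj at hN
  obtain ⟨s, hs⟩ := Module.projective_lifting_property
    (toR (R := R) N.mkQ.toAddMonoidHom (fun c x => N.mkQ.map_smul (algebraMap R A c) x))
    LinearMap.id N.mkQ_surjective
  let t : X ⧸ N →+ X := s.toAddMonoidHom
  have ht : ∀ x, N.mkQ (t x) = x := fun x => LinearMap.congr_fun hs x
  have hts : ∀ (c : R) (x : X ⧸ N), t (algebraMap R A c • x) = algebraMap R A c • t x :=
    fun c x => s.map_smul c x
  have hmem : ∀ x, x - t (N.mkQ x) ∈ N := fun x => by
    rw [← Submodule.Quotient.mk_eq_zero, ← Submodule.mkQ_apply, map_sub, ht, sub_self]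
  refine ⟨⟨⟨fun x => ⟨x - t (N.mkQ x), hmem x⟩, ?_⟩, ?_⟩, ?_, ?_⟩
  · ext; simp
  · intro x y
    ext
    simp only [map_add, Submodule.coe_add]
    abel
  · intro c x
    ext
    change algebraMap R A c • x - t (N.mkQ (algebraMap R A c • x)) =
      algebraMap R A c • (x - t (N.mkQ x))
    rw [map_smul, hts, smul_sub]
  · intro x
    ext
    change (x : X) - t (N.mkQ x) = x
    have : N.mkQ (x : X) = 0 := by simp
    rw [this, map_zero, sub_zero]

lemma rproj_sub (N : Submodule A X) (hX : RProj R A X) (hN : RSummand R A N) :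
    RProj R A N := by
  obtain ⟨r, hr, hrN⟩ := hN
  exact rproj_retract' hX N.subtype.toAddMonoidHom (fun _ _ => rfl) r hr hrN

end Helpers9

end RelDom

open RelDom Function TensorProduct

section Stmt9

variable (R : Type u) [CommRing R] [IsNoetherianRing R]
variable (A : Type u) [Ring A] [Algebra R A] [Module.Finite R A] [Module.Projective R A]
variable (Q : Type u) [AddCommGroup Q] [Module R Q] [Module A Q]
  [IsScalarTower R A Q] [SMulCommClass A R Q] [SMulCommClass R A Q]
  [Module.Finite A Q] [Module.Projective R Q]

/-- Suppose `Ext_A^{i>0}(Q,Q) = 0`, `DQ ⊗_A Q ∈ R-proj`, and let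
`M := C 0` be finitely generated, projective over `R`, with `Ext_A^{i>0}(M,Q) = 0`
(`M ∈ ⊥Q`).  Given an exact sequence `0 → M → C 1 → ⋯ → C (m+1)` (of length
`n = m + 1`), the sequence witnesses `Q-domdim_{(A,R)} M ≥ n` — i.e. all its terms
`C i` (`1 ≤ i ≤ n`) lie in `add Q`, it is `(A,R)`-exact and it remains exact under
`Hom_A(-, Q)` — if and only if all `C i` lie in `add Q` and the cokernel of
`C m → C (m+1)` lies in `⊥Q` (and is projective over `R`). -/
theorem stmt_9
    (hQQ : Module.Projective R (TensorOver R A (Q →ₗ[R] R) Q))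
    (hQext : ∀ i, 0 < i → ExtVanish A (ModuleCat.of A Q) (ModuleCat.of A Q) i)
    (m : ℕ) (C : ℕ → ModuleCat.{u} A)
    (d : ∀ i, (C i : Type u) →ₗ[A] (C (i+1) : Type u))
    [Module.Finite A (C 0 : Type u)]
    [Module.Projective R (RestrictScalars R A (C 0 : Type u))]
    (hMext : ∀ i, 0 < i → ExtVanish A (C 0) (ModuleCat.of A Q) i)
    (hinj : Injective (d 0))
    (hex : ∀ i, i + 2 ≤ m + 1 →
      LinearMap.ker (d (i+1)) = LinearMap.range (d i)) :
    ((∀ i, 1 ≤ i → i ≤ m + 1 → InAdd A Q (C i : Type u)) ∧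
      (∀ i, i ≤ m → RSummand R A (LinearMap.range (d i))) ∧
      (∀ h : (C 0 : Type u) →ₗ[A] Q,
        ∃ H : (C 1 : Type u) →ₗ[A] Q, H ∘ₗ d 0 = h) ∧
      (∀ j, j + 1 ≤ m → ∀ h : (C (j+1) : Type u) →ₗ[A] Q, h ∘ₗ d j = 0 →
        ∃ H : (C (j+2) : Type u) →ₗ[A] Q, H ∘ₗ d (j+1) = h))
    ↔
    ((∀ i, 1 ≤ i → i ≤ m + 1 → InAdd A Q (C i : Type u)) ∧
      (∀ j, 0 < j → ExtVanish A
        (ModuleCat.of A ((C (m+1) : Type u) ⧸ LinearMap.range (d m)))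
        (ModuleCat.of A Q) j) ∧
      Module.Projective R
        (RestrictScalars R A ((C (m+1) : Type u) ⧸ LinearMap.range (d m)))) := by
  have hQ : EV A Q Q := hQext
  have hM : EV A (C 0) Q := hMext
  -- the quotient of the middle term is the next image
  have equiv : ∀ j, j + 1 ≤ m →
      Nonempty (((C (j+1) : Type u) ⧸ LinearMap.range (d j)) ≃ₗ[A] LinearMap.range (d (j+1))) := by
    intro j hj
    exact ⟨(Submodule.quotEquivOfEq _ _ (hex j (by omega)).symm).trans
      (d (j+1)).quotKerEquivRange⟩
  constructor
  · rintro ⟨hadd, hsum, hhom0, hhom⟩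
    have hEC : ∀ i, i ≤ m → EV A (C (i+1)) Q := fun i hi =>
      ev_inAdd hQ (hadd (i+1) (by omega) (by omega))
    have ext0 : ∀ h : LinearMap.range (d 0) →ₗ[A] Q,
        ∃ H : (C 1 : Type u) →ₗ[A] Q, H ∘ₗ (LinearMap.range (d 0)).subtype = h := by
      intro h
      obtain ⟨H, hH⟩ := hhom0 (h ∘ₗ (d 0).rangeRestrict)
      refine ⟨H, LinearMap.ext ?_⟩
      rintro ⟨_, x, rfl⟩
      exact LinearMap.congr_fun hH x
    have exts : ∀ j, j + 1 ≤ m → ∀ h : LinearMap.range (d (j+1)) →ₗ[A] Q,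
        ∃ H : (C (j+2) : Type u) →ₗ[A] Q, H ∘ₗ (LinearMap.range (d (j+1))).subtype = h := by
      intro j hj h
      obtain ⟨H, hH⟩ := hhom j hj (h ∘ₗ (d (j+1)).rangeRestrict) (by
        ext x
        have hx : d j x ∈ LinearMap.ker (d (j+1)) := by
          rw [hex j (by omega)]
          exact ⟨x, rfl⟩
        have : (d (j+1)).rangeRestrict (d j x) = 0 := Subtype.ext hx
        simp [this])
      refine ⟨H, LinearMap.ext ?_⟩
      rintro ⟨_, x, rfl⟩
      exact LinearMap.congr_fun hH x
    have key : ∀ i, i ≤ m → EV A ((C (i+1) : Type u) ⧸ LinearMap.range (d i)) Q := by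
      intro i
      induction i with
      | zero =>
        intro h0
        refine ev_quot _ (hEC 0 h0) ?_ ext0
        let e := LinearEquiv.ofInjective (d 0) hinj
        exact ev_retract hM e.symm.toLinearMap e.toLinearMap (fun x => e.apply_symm_apply x)
      | succ j ih =>
        intro hj
        obtain ⟨e⟩ := equiv j hj
        refine ev_quot _ (hEC (j+1) hj) ?_ (exts j hj)
        exact ev_retract (ih (by omega)) e.symm.toLinearMap e.toLinearMap
          (fun x => e.apply_symm_apply x)
    refine ⟨hadd, key m le_rfl, ?_⟩
    exact rproj_quot _ (rproj_inAdd (hadd (m+1) (by omega) le_rfl)) (hsum m le_rfl)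
  · rintro ⟨hadd, hev, hproj⟩
    have hEC : ∀ i, i ≤ m → EV A (C (i+1)) Q := fun i hi =>
      ev_inAdd hQ (hadd (i+1) (by omega) (by omega))
    have hPC : ∀ i, i ≤ m → RProj R A (C (i+1)) := fun i hi =>
      rproj_inAdd (hadd (i+1) (by omega) (by omega))
    have key : ∀ k i, i + k = m → EV A ((C (i+1) : Type u) ⧸ LinearMap.range (d i)) Q ∧
        RProj R A ((C (i+1) : Type u) ⧸ LinearMap.range (d i)) := by
      intro k
      induction k with
      | zero =>
        intro i hi
        obtain rfl : i = m := hi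
        exact ⟨hev, hproj⟩
      | succ k ih =>
        intro i hi
        obtain ⟨h1, h2⟩ := ih (i+1) (by omega)
        obtain ⟨e⟩ := equiv i (by omega)
        exact ⟨ev_retract (ev_sub _ (hEC (i+1) (by omega)) h1) e.toLinearMap e.symm.toLinearMap
            (fun x => e.symm_apply_apply x),
          rproj_retract (rproj_sub _ (hPC (i+1) (by omega)) (rsummand_of_quot _ h2))
            e.toLinearMap e.symm.toLinearMap (fun x => e.symm_apply_apply x)⟩
    refine ⟨hadd, fun i hi => rsummand_of_quot _ (key (m - i) i (by omega)).2, ?_, ?_⟩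
    · intro h
      let e := LinearEquiv.ofInjective (d 0) hinj
      obtain ⟨H, hH⟩ := hom_extend _ (key m 0 (by omega)).1 (h ∘ₗ e.symm.toLinearMap)
      refine ⟨H, LinearMap.ext fun x => ?_⟩
      have := LinearMap.congr_fun hH (e x)
      simpa [e] using this
    · intro j hj h hh
      let q := (LinearMap.range (d j)).liftQ h (by
        rintro _ ⟨x, rfl⟩
        exact LinearMap.congr_fun hh x)
      let e := (Submodule.quotEquivOfEq _ _ (hex j (by omega)).symm).trans
        (d (j+1)).quotKerEquivRange
      obtain ⟨H, hH⟩ := hom_extend _ (key (m - (j+1)) (j+1) (by omega)).1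
        (q ∘ₗ e.symm.toLinearMap)
      refine ⟨H, LinearMap.ext fun x => ?_⟩
      have := LinearMap.congr_fun hH (e (Submodule.Quotient.mk x))
      simp only [LinearMap.comp_apply, LinearEquiv.coe_coe, LinearEquiv.symm_apply_apply] at this
      exact this

end Stmt9
end
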